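/- arXiv:2603.18268 — 5 statements merged into one kernel-verified Lean document; each statement's English description precedes it below -/
import Mathlib

section
/- Let $n, m \ge 1$ and let $X$ be an $n$-dimensional real normed space with $d_{BM}(X, \ell_1^n) \le 3$. Then $d_{BM}(X \oplus_1 \ell_1^m, \ell_1^{n+m}) = d_{BM}(X, \ell_1^n)$. -/
open scoped ENNReal

/-- The (multiplicative) Banach–Mazur distance between two normed spaces:
the infimum of `‖T‖ * ‖T⁻¹‖` over invertible (continuous) linear maps `T : E → F`. -/
noncomputable def dBM (E F : Type*) [NormedAddCommGroup E] [NormedSpace ℝ E]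
    [NormedAddCommGroup F] [NormedSpace ℝ F] : ℝ :=
  sInf {c : ℝ | ∃ T : E ≃L[ℝ] F, c = ‖(T : E →L[ℝ] F)‖ * ‖(T.symm : F →L[ℝ] E)‖}


/-- One elimination step: a well-spread family of `p+1` vectors in `Y ⊕₁ ℝ`, with `dim Y = p`,
produces a well-spread family of `p` vectors in `Y`. -/
theorem elim_step {Y : Type*} [AddCommGroup Y] [Module ℝ Y] [FiniteDimensional ℝ Y]
    (N : Y → ℝ) (N0 : N 0 = 0) (Nadd : ∀ x y, N (x + y) ≤ N x + N y)
    (Nsmul : ∀ (r : ℝ) x, N (r • x) = |r| * N x)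
    (p : ℕ) (hp : Module.finrank ℝ Y = p) (D : ℝ) (hD0 : 0 < D) (hD : D ≤ 3)
    (y : Fin (p + 1) → Y) (t : Fin (p + 1) → ℝ) (h1 : ∀ i, N (y i) + |t i| ≤ 1)
    (h2 : ∀ a : Fin (p + 1) → ℝ,
      ∑ i, |a i| ≤ D * (N (∑ i, a i • y i) + |∑ i, a i * t i|)) :
    ∃ w : Fin p → Y, (∀ i, N (w i) ≤ 1) ∧
      ∀ b : Fin p → ℝ, ∑ i, |b i| ≤ D * N (∑ i, b i • w i) := by
  have Nnn : ∀ x, 0 ≤ N x := by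
    intro x
    have e1 := Nadd x ((-1 : ℝ) • x)
    rw [Nsmul] at e1
    have : x + (-1 : ℝ) • x = 0 := by simp
    rw [this, N0] at e1
    simp at e1
    linarith
  obtain ⟨j, hj⟩ : ∃ j, 1 ≤ D * |t j| := by
    by_contra hcon
    push Not at hcon
    have hnl : ¬ LinearIndependent ℝ y := by
      intro hl
      have := hl.fintype_card_le_finrank
      simp [hp] at this
    rw [Fintype.not_linearIndependent_iff] at hnl
    obtain ⟨a, ha0, i0, hi0⟩ := hnl
    have e := h2 a
    rw [ha0, N0, zero_add] at e
    have e2 : D * |∑ i, a i * t i| ≤ ∑ i, |a i| * (D * |t i|) := by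
      calc D * |∑ i, a i * t i| ≤ D * ∑ i, |a i * t i| := by
            gcongr
            exact Finset.abs_sum_le_sum_abs _ _
        _ = _ := by
            rw [Finset.mul_sum]
            refine Finset.sum_congr rfl fun i _ => ?_
            rw [abs_mul]; ring
    have e3 : ∑ i, |a i| * (D * |t i|) < ∑ i, |a i| := by
      refine Finset.sum_lt_sum (fun i _ => ?_) ⟨i0, Finset.mem_univ _, ?_⟩
      · nlinarith [abs_nonneg (a i), hcon i]
      · have := abs_pos.2 hi0
        nlinarith [hcon i0]
    linarith
  have htpos : 0 < |t j| := by
    rcases (abs_nonneg (t j)).lt_or_eq with hh | hh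
    · exact hh
    · rw [← hh] at hj; norm_num at hj
  have htj : t j ≠ 0 := abs_pos.1 htpos
  have ht1 : |t j| ≤ 1 := by linarith [h1 j, Nnn (y j)]
  obtain ⟨l, hl0, hl1, hla, hlb⟩ : ∃ l : ℝ, 0 ≤ l ∧ l ≤ 1 ∧ l * (1 - |t j|) ≤ |t j| ∧
      D * (1 - l) * |t j| ≤ l := by
    by_cases hh : 1 / 2 ≤ |t j|
    · exact ⟨1, by norm_num, le_rfl, by linarith, by simp⟩
    · push Not at hh
      have hpos : 0 < 1 - |t j| := by linarith
      refine ⟨|t j| / (1 - |t j|), by positivity, ?_, ?_, ?_⟩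
      · rw [div_le_one hpos]; linarith
      · rw [div_mul_cancel₀ _ hpos.ne']
      · have : 1 - |t j| / (1 - |t j|) = (1 - 2 * |t j|) / (1 - |t j|) := by
          field_simp; ring
        rw [this, mul_div_assoc', div_mul_eq_mul_div]
        gcongr
        nlinarith
  refine ⟨fun i => y (j.succAbove i) + (-(l * t (j.succAbove i) / t j)) • y j, ?_, ?_⟩
  · intro i
    refine (Nadd _ _).trans ?_
    rw [Nsmul, abs_neg, abs_div, abs_mul, abs_of_nonneg hl0]
    have a1 := h1 (j.succAbove i)
    have a2 : N (y j) ≤ 1 - |t j| := by linarith [h1 j]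
    have a3 : l * |t (j.succAbove i)| / |t j| * N (y j) ≤ |t (j.succAbove i)| := by
      calc l * |t (j.succAbove i)| / |t j| * N (y j)
          ≤ l * |t (j.succAbove i)| / |t j| * (1 - |t j|) := by gcongr
        _ = |t (j.succAbove i)| / |t j| * (l * (1 - |t j|)) := by ring
        _ ≤ |t (j.succAbove i)| / |t j| * |t j| := by gcongr
        _ = _ := div_mul_cancel₀ _ htpos.ne'
    linarith
  · intro b
    set s := ∑ i, b i * t (j.succAbove i) with hs
    have e := h2 (j.insertNth (-(l * s / t j)) b)
    simp only [Fin.sum_univ_succAbove _ j, Fin.insertNth_apply_same,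
      Fin.insertNth_apply_succAbove] at e
    rw [← hs] at e
    have e1 : -(l * s / t j) * t j + s = (1 - l) * s := by field_simp; ring
    have e2 : ∑ i, b i • (y (j.succAbove i) + (-(l * t (j.succAbove i) / t j)) • y j)
        = -(l * s / t j) • y j + ∑ i, b i • y (j.succAbove i) := by
      simp only [smul_add, Finset.sum_add_distrib, smul_smul]
      rw [add_comm, ← Finset.sum_smul]
      congr 2
      rw [hs, Finset.mul_sum, Finset.sum_div, ← Finset.sum_neg_distrib]
      refine Finset.sum_congr rfl fun i _ => ?_
      ring
    rw [e2]
    rw [e1, abs_neg, abs_div, abs_mul, abs_mul, abs_of_nonneg hl0,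
      abs_of_nonneg (sub_nonneg.2 hl1)] at e
    have e3 : D * ((1 - l) * |s|) ≤ l * |s| / |t j| := by
      rw [le_div_iff₀ htpos]
      nlinarith [abs_nonneg s]
    linarith

/-- A family of `p` vectors in `E` witnessing distance at most `D` from `ℓ₁ᵖ`. -/
def Spread (E : Type*) [NormedAddCommGroup E] [NormedSpace ℝ E] (p : ℕ) (D : ℝ) : Prop :=
  ∃ w : Fin p → E, (∀ i, ‖w i‖ ≤ 1) ∧
    ∀ a : Fin p → ℝ, ∑ i, |a i| ≤ D * ‖∑ i, a i • w i‖

theorem l1_norm {p : ℕ} (a : PiLp 1 fun _ : Fin p => ℝ) : ‖a‖ = ∑ i, |a i| := by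
  simp [PiLp.norm_eq_sum (p := 1) (by norm_num)]

theorem elim_all {X : Type*} [NormedAddCommGroup X] [NormedSpace ℝ X] [FiniteDimensional ℝ X]
    (n : ℕ) (hn : Module.finrank ℝ X = n) (D : ℝ) (hD0 : 0 < D) (hD : D ≤ 3) (k : ℕ) :
    ∀ (x : Fin (n + k) → X) (t : Fin (n + k) → Fin k → ℝ),
    (∀ i, ‖x i‖ + ∑ l, |t i l| ≤ 1) →
    (∀ a : Fin (n + k) → ℝ,
      ∑ i, |a i| ≤ D * (‖∑ i, a i • x i‖ + ∑ l, |∑ i, a i * t i l|)) → Spread X n D := by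
  induction k with
  | zero =>
    intro x t h1 h2
    exact ⟨x, fun i => by simpa using h1 i, fun a => by simpa using h2 a⟩
  | succ k ih =>
    intro x t h1 h2
    obtain ⟨w, hw1, hw2⟩ := elim_step (Y := X × (Fin k → ℝ))
      (fun z => ‖z.1‖ + ∑ l, |z.2 l|) (by simp)
      (fun z z' => by
        have a1 := norm_add_le z.1 z'.1
        have a2 : ∑ l, |z.2 l + z'.2 l| ≤ ∑ l, |z.2 l| + ∑ l, |z'.2 l| := by
          rw [← Finset.sum_add_distrib]
          exact Finset.sum_le_sum fun l _ => abs_add_le _ _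
        simp only [Prod.fst_add, Prod.snd_add, Pi.add_apply]
        linarith)
      (fun r z => by
        simp [norm_smul, abs_mul, mul_add, Finset.mul_sum])
      (n + k) (by simp [hn]) D hD0 hD
      (fun i => (x i, fun l => t i l.succ)) (fun i => t i 0)
      (fun i => by
        have := h1 i
        rw [Fin.sum_univ_succ] at this
        simp only
        linarith)
      (fun a => by
        have := h2 a
        rw [Fin.sum_univ_succ (n := k)] at this
        simp only [Prod.fst_sum, Prod.snd_sum, Prod.smul_fst, Prod.smul_snd, Finset.sum_apply,
          Pi.smul_apply, smul_eq_mul]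
        have key : ∀ A B C : ℝ, D * (A + (B + C)) = D * (A + C + B) := by intros; ring
        exact this.trans (le_of_eq (key _ _ _)))
    refine ih (fun i => (w i).1) (fun i => (w i).2) hw1 (fun a => ?_)
    have := hw2 a
    simpa only [Prod.fst_sum, Prod.snd_sum, Prod.smul_fst, Prod.smul_snd, Finset.sum_apply,
          Pi.smul_apply, smul_eq_mul] using this

theorem l1_sum {E : Type*} [NormedAddCommGroup E] [NormedSpace ℝ E] {p : ℕ}
    (T : E ≃L[ℝ] (PiLp 1 fun _ : Fin p => ℝ)) (a : Fin p → ℝ) :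
    T.symm (WithLp.toLp 1 a) = ∑ i, a i • T.symm (PiLp.single 1 i (1 : ℝ)) := by
  have : WithLp.toLp 1 a = ∑ i, a i • (PiLp.single 1 i (1 : ℝ) : PiLp 1 fun _ : Fin p => ℝ) := by
    ext j
    simp [Pi.single_apply]
  rw [this, map_sum]
  simp

theorem spread_of_equiv {E : Type*} [NormedAddCommGroup E] [NormedSpace ℝ E] {p : ℕ} (hp : 1 ≤ p)
    (T : E ≃L[ℝ] (PiLp 1 fun _ : Fin p => ℝ)) :
    1 ≤ ‖(T : E →L[ℝ] (PiLp 1 fun _ : Fin p => ℝ))‖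
        * ‖(T.symm : (PiLp 1 fun _ : Fin p => ℝ) →L[ℝ] E)‖ ∧
    Spread E p (‖(T : E →L[ℝ] (PiLp 1 fun _ : Fin p => ℝ))‖
        * ‖(T.symm : (PiLp 1 fun _ : Fin p => ℝ) →L[ℝ] E)‖) := by
  set A := ‖(T : E →L[ℝ] (PiLp 1 fun _ : Fin p => ℝ))‖ with hA
  set B := ‖(T.symm : (PiLp 1 fun _ : Fin p => ℝ) →L[ℝ] E)‖ with hB
  have hTle : ∀ v, ‖T v‖ ≤ A * ‖v‖ := fun v =>
    (T : E →L[ℝ] (PiLp 1 fun _ : Fin p => ℝ)).le_opNorm v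
  have hSle : ∀ v, ‖T.symm v‖ ≤ B * ‖v‖ := fun v =>
    (T.symm : (PiLp 1 fun _ : Fin p => ℝ) →L[ℝ] E).le_opNorm v
  have hsing : ∀ i : Fin p, ‖(PiLp.single 1 i (1 : ℝ) : PiLp 1 fun _ : Fin p => ℝ)‖ = 1 := by
    intro i
    simp
  have hA0 : 0 ≤ A := norm_nonneg _
  have hB0 : 0 ≤ B := norm_nonneg _
  have h1 : 1 ≤ A * B := by
    have e := hTle (T.symm (PiLp.single 1 ⟨0, hp⟩ (1 : ℝ)))
    have e2 := hSle (PiLp.single 1 ⟨0, hp⟩ (1 : ℝ))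
    rw [T.apply_symm_apply, hsing] at e
    rw [hsing] at e2
    nlinarith
  have hBpos : 0 < B := by
    rcases hB0.lt_or_eq with hh | hh
    · exact hh
    · rw [← hh] at h1; norm_num at h1
  refine ⟨h1, fun i => B⁻¹ • T.symm (PiLp.single 1 i (1 : ℝ)), fun i => ?_, fun a => ?_⟩
  · rw [norm_smul, Real.norm_eq_abs, abs_of_pos (inv_pos.2 hBpos)]
    have := hSle (PiLp.single 1 i (1 : ℝ))
    rw [hsing, mul_one] at this
    rw [inv_mul_le_iff₀ hBpos]
    linarith
  · have e := hTle (T.symm (WithLp.toLp 1 a))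
    rw [T.apply_symm_apply, l1_norm, l1_sum] at e
    have e2 : ∑ i, a i • B⁻¹ • T.symm (PiLp.single 1 i (1 : ℝ))
        = B⁻¹ • ∑ i, a i • T.symm (PiLp.single 1 i (1 : ℝ)) := by
      rw [Finset.smul_sum]
      refine Finset.sum_congr rfl fun i _ => ?_
      rw [smul_comm]
    rw [e2, norm_smul, Real.norm_eq_abs, abs_of_pos (inv_pos.2 hBpos)]
    refine e.trans (le_of_eq ?_)
    field_simp

theorem dBM_le_of_spread {E : Type*} [NormedAddCommGroup E] [NormedSpace ℝ E]
    [FiniteDimensional ℝ E] {p : ℕ} (hE : Module.finrank ℝ E = p) {D : ℝ} (hD : 0 < D)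
    (h : Spread E p D) : dBM E (PiLp 1 fun _ : Fin p => ℝ) ≤ D := by
  obtain ⟨w, hw1, hw2⟩ := h
  have hli : LinearIndependent ℝ w := by
    rw [Fintype.linearIndependent_iff]
    intro a ha i
    have e := hw2 a
    rw [ha, norm_zero, mul_zero] at e
    have e2 : |a i| ≤ ∑ i, |a i| :=
      Finset.single_le_sum (f := fun i => |a i|) (fun i _ => abs_nonneg _) (Finset.mem_univ i)
    exact abs_nonpos_iff.1 (e2.trans e)
  have hspan : ⊤ ≤ Submodule.span ℝ (Set.range w) :=
    (hli.span_eq_top_of_card_eq_finrank' (by simp [hE])).ge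
  let b : Module.Basis (Fin p) ℝ E := Module.Basis.mk hli hspan
  let T : E ≃L[ℝ] (PiLp 1 fun _ : Fin p => ℝ) :=
    (b.equivFun.trans (WithLp.linearEquiv 1 ℝ (Fin p → ℝ)).symm).toContinuousLinearEquiv
  have hTs : ∀ a : PiLp 1 fun _ : Fin p => ℝ, T.symm a = ∑ i, a i • w i := by
    intro a
    change b.equivFun.symm (WithLp.ofLp a) = _
    rw [Module.Basis.equivFun_symm_apply]
    simp [b]
  have hT1 : ‖(T.symm : (PiLp 1 fun _ : Fin p => ℝ) →L[ℝ] E)‖ ≤ 1 := by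
    refine ContinuousLinearMap.opNorm_le_bound _ zero_le_one fun a => ?_
    change ‖T.symm a‖ ≤ _
    rw [hTs, one_mul, l1_norm]
    refine (norm_sum_le _ _).trans (Finset.sum_le_sum fun i _ => ?_)
    rw [norm_smul, Real.norm_eq_abs]
    exact mul_le_of_le_one_right (abs_nonneg _) (hw1 i)
  have hT2 : ‖(T : E →L[ℝ] (PiLp 1 fun _ : Fin p => ℝ))‖ ≤ D := by
    refine ContinuousLinearMap.opNorm_le_bound _ hD.le fun v => ?_
    change ‖T v‖ ≤ _
    have e := hw2 (T v)
    rw [← hTs, T.symm_apply_apply] at e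
    rw [l1_norm]
    exact e
  have hmem : dBM E (PiLp 1 fun _ : Fin p => ℝ) ≤ ‖(T : E →L[ℝ] (PiLp 1 fun _ : Fin p => ℝ))‖
        * ‖(T.symm : (PiLp 1 fun _ : Fin p => ℝ) →L[ℝ] E)‖ := by
    refine csInf_le ⟨0, ?_⟩ ⟨T, rfl⟩
    rintro c ⟨S, rfl⟩
    positivity
  refine hmem.trans ?_
  calc _ ≤ D * 1 := by gcongr
    _ = D := mul_one D

theorem le_dBM {E : Type*} [NormedAddCommGroup E] [NormedSpace ℝ E]
    [FiniteDimensional ℝ E] {p : ℕ} (hE : Module.finrank ℝ E = p) (hp : 1 ≤ p) (c : ℝ)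
    (h : ∀ D, 1 ≤ D → Spread E p D → c ≤ D) : c ≤ dBM E (PiLp 1 fun _ : Fin p => ℝ) := by
  refine le_csInf ?_ ?_
  · have hf : Module.finrank ℝ E = Module.finrank ℝ (PiLp 1 fun _ : Fin p => ℝ) := by
      rw [hE, (WithLp.linearEquiv 1 ℝ (Fin p → ℝ)).finrank_eq]
      simp
    exact ⟨_, ContinuousLinearEquiv.ofFinrankEq hf, rfl⟩
  · rintro _ ⟨T, rfl⟩
    obtain ⟨h1, h2⟩ := spread_of_equiv hp T
    exact h _ h1 h2

theorem sum_norm {X : Type*} [NormedAddCommGroup X] [NormedSpace ℝ X] {m : ℕ}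
    (z : WithLp 1 (X × PiLp 1 fun _ : Fin m => ℝ)) : ‖z‖ = ‖z.fst‖ + ∑ l, |z.snd l| := by
  rw [← l1_norm, WithLp.prod_norm_eq_of_L1]

theorem fst_sum_aux {X : Type*} [NormedAddCommGroup X] [NormedSpace ℝ X] {m q : ℕ}
    (a : Fin q → ℝ) (w : Fin q → WithLp 1 (X × PiLp 1 fun _ : Fin m => ℝ)) :
    (∑ i, a i • w i).fst = ∑ i, a i • (w i).fst := by
  have := map_sum (WithLp.fstL 1 ℝ X (PiLp 1 fun _ : Fin m => ℝ)) (fun i => a i • w i) Finset.univ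
  simp only [WithLp.fstL_apply] at this
  rw [this]
  simp

theorem snd_sum_aux {X : Type*} [NormedAddCommGroup X] [NormedSpace ℝ X] {m q : ℕ}
    (a : Fin q → ℝ) (w : Fin q → WithLp 1 (X × PiLp 1 fun _ : Fin m => ℝ)) (l : Fin m) :
    (∑ i, a i • w i).snd l = ∑ i, a i * (w i).snd l := by
  have := map_sum (WithLp.sndL 1 ℝ X (PiLp 1 fun _ : Fin m => ℝ)) (fun i => a i • w i) Finset.univ
  simp only [WithLp.sndL_apply] at this
  rw [this]
  simp

/-- for an `n`-dimensional normed space `X` with `d_BM(X, ℓ₁ⁿ) ≤ 3`,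
`d_BM(X ⊕₁ ℓ₁ᵐ, ℓ₁ⁿ⁺ᵐ) = d_BM(X, ℓ₁ⁿ)`. -/
theorem stmt_8 (n m : ℕ) (hn : 1 ≤ n) (hm : 1 ≤ m)
    (X : Type) [NormedAddCommGroup X] [NormedSpace ℝ X] [FiniteDimensional ℝ X]
    (hdim : Module.finrank ℝ X = n)
    (h : dBM X (PiLp 1 fun _ : Fin n => ℝ) ≤ 3) :
    dBM (WithLp 1 (X × PiLp 1 fun _ : Fin m => ℝ)) (PiLp 1 fun _ : Fin (n + m) => ℝ) =
      dBM X (PiLp 1 fun _ : Fin n => ℝ) := by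
  have hdim2 : Module.finrank ℝ (WithLp 1 (X × PiLp 1 fun _ : Fin m => ℝ)) = n + m := by
    rw [(WithLp.linearEquiv 1 ℝ (X × PiLp 1 fun _ : Fin m => ℝ)).finrank_eq,
      Module.finrank_prod, hdim, (WithLp.linearEquiv 1 ℝ (Fin m → ℝ)).finrank_eq]
    simp
  apply le_antisymm
  · refine le_dBM hdim hn _ fun D hD hS => ?_
    refine dBM_le_of_spread hdim2 (by linarith) ?_
    obtain ⟨w, hw1, hw2⟩ := hS
    refine ⟨Fin.append (fun i => WithLp.toLp 1 (w i, 0))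
      (fun l => WithLp.toLp 1 (0, PiLp.single 1 l (1 : ℝ))), fun i => ?_, fun a => ?_⟩
    · refine Fin.addCases (fun i => ?_) (fun l => ?_) i
      · simpa [WithLp.prod_norm_eq_of_L1] using hw1 i
      · simp [WithLp.prod_norm_eq_of_L1]
    · rw [sum_norm, fst_sum_aux]
      simp only [snd_sum_aux]
      simp only [Fin.sum_univ_add, Fin.append_left, Fin.append_right]
      have e := hw2 (fun i => a (Fin.castAdd m i))
      have e2 : ∑ l : Fin m, |a (Fin.natAdd n l)| ≤ D * ∑ l : Fin m, |a (Fin.natAdd n l)| :=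
        le_mul_of_one_le_left (Finset.sum_nonneg fun _ _ => abs_nonneg _) hD
      simp [Pi.single_apply]
      linarith
  · refine le_dBM hdim2 (by omega) _ fun D hD hS => ?_
    by_cases h3 : 3 ≤ D
    · exact h.trans h3
    · push Not at h3
      obtain ⟨w, hw1, hw2⟩ := hS
      refine dBM_le_of_spread hdim (by linarith) ?_
      refine elim_all n hdim D (by linarith) h3.le m (fun i => (w i).fst)
        (fun i l => (w i).snd l) (fun i => ?_) (fun a => ?_)
      · rw [← sum_norm]; exact hw1 i
      · have e := hw2 a
        rw [sum_norm, fst_sum_aux] at e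
        simpa only [snd_sum_aux] using e
end

section
/- Let $n, m \ge 1$ and let $X$ be an $n$-dimensional real normed space with $d_{BM}(X, \ell_\infty^n) \le 3$. Then $d_{BM}(X \oplus_\infty \ell_\infty^m, \ell_\infty^{n+m}) = d_{BM}(X, \ell_\infty^n)$. -/
open scoped ENNReal

/-- `E` embeds with distortion `d` by `k` functionals. -/
def PF (E : Type*) [NormedAddCommGroup E] [NormedSpace ℝ E] (k : ℕ) (d : ℝ) : Prop :=
  ∃ f : Fin k → (E →ₗ[ℝ] ℝ), (∀ i x, |f i x| ≤ d * ‖x‖) ∧ ∀ x, x ≠ 0 → ∃ i, ‖x‖ ≤ |f i x|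

lemma PF_of_equiv {E : Type*} [NormedAddCommGroup E] [NormedSpace ℝ E] (k : ℕ)
    (T : E ≃L[ℝ] (PiLp ∞ fun _ : Fin k => ℝ)) (hk : 1 ≤ k) :
    PF E k (‖(T : E →L[ℝ] (PiLp ∞ fun _ : Fin k => ℝ))‖ *
      ‖(T.symm : (PiLp ∞ fun _ : Fin k => ℝ) →L[ℝ] E)‖) := by
  set b := ‖(T.symm : (PiLp ∞ fun _ : Fin k => ℝ) →L[ℝ] E)‖ with hb
  have hb0 : 0 ≤ b := norm_nonneg _
  have hfi : ∀ i x, (b • (LinearMap.proj i ∘ₗ (WithLp.linearEquiv ∞ ℝ (Fin k → ℝ)).toLinearMap ∘ₗ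
      T.toLinearEquiv.toLinearMap) : E →ₗ[ℝ] ℝ) x = b * (T x) i := by
    intro i x; simp
  refine ⟨fun i => b • (LinearMap.proj i ∘ₗ
    (WithLp.linearEquiv ∞ ℝ (Fin k → ℝ)).toLinearMap ∘ₗ T.toLinearEquiv.toLinearMap), ?_, ?_⟩
  · intro i x
    rw [hfi, abs_mul, abs_of_nonneg hb0]
    have h1 : |(T x) i| ≤ ‖T x‖ := PiLp.norm_apply_le (T x) i
    have h2 := (T : E →L[ℝ] (PiLp ∞ fun _ : Fin k => ℝ)).le_opNorm x
    have h3 : |(T x) i| ≤ ‖(T : E →L[ℝ] (PiLp ∞ fun _ : Fin k => ℝ))‖ * ‖x‖ := h1.trans h2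
    nlinarith [mul_le_mul_of_nonneg_left h3 hb0]
  · intro x _
    have : Nonempty (Fin k) := ⟨⟨0, hk⟩⟩
    obtain ⟨i, hi⟩ := exists_eq_ciSup_of_finite (f := fun i => ‖(T x) i‖)
    refine ⟨i, ?_⟩
    rw [hfi, abs_mul, abs_of_nonneg hb0]
    have h2 := (T.symm : (PiLp ∞ fun _ : Fin k => ℝ) →L[ℝ] E).le_opNorm (T x)
    rw [PiLp.norm_eq_ciSup, ← hi] at h2
    simpa using h2

lemma dBM_le_of_PF {E : Type*} [NormedAddCommGroup E] [NormedSpace ℝ E] [FiniteDimensional ℝ E]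
    (k : ℕ) (d : ℝ) (hd : 0 ≤ d) (hE : Module.finrank ℝ E = k) (h : PF E k d) :
    dBM E (PiLp ∞ fun _ : Fin k => ℝ) ≤ d := by
  obtain ⟨f, hf1, hf2⟩ := h
  let L : E →ₗ[ℝ] (PiLp ∞ fun _ : Fin k => ℝ) :=
    (WithLp.linearEquiv ∞ ℝ (Fin k → ℝ)).symm.toLinearMap ∘ₗ LinearMap.pi f
  have hL : ∀ x i, (L x) i = f i x := fun x i => rfl
  have hlow : ∀ x, ‖x‖ ≤ ‖L x‖ := by
    intro x
    by_cases hx : x = 0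
    · simp [hx]
    · obtain ⟨i, hi⟩ := hf2 x hx
      exact hi.trans (PiLp.norm_apply_le (L x) i)
  have hinj : Function.Injective L := by
    rw [injective_iff_map_eq_zero]
    intro x hx
    have := hlow x
    rw [hx, norm_zero] at this
    exact norm_le_zero_iff.1 this
  have hup : ∀ x, ‖L x‖ ≤ d * ‖x‖ := by
    intro x
    rw [PiLp.norm_eq_ciSup]
    exact Real.iSup_le (fun i => hf1 i x) (by positivity)
  have hfr : Module.finrank ℝ E = Module.finrank ℝ (PiLp ∞ fun _ : Fin k => ℝ) := by
    rw [hE, LinearEquiv.finrank_eq (WithLp.linearEquiv ∞ ℝ (Fin k → ℝ))]; simp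
  let e := (LinearEquiv.ofInjectiveOfFinrankEq L hinj hfr)
  have he : ∀ x, e x = L x := fun x => rfl
  let T : E ≃L[ℝ] (PiLp ∞ fun _ : Fin k => ℝ) := e.toContinuousLinearEquiv
  have hT : ∀ x, T x = L x := fun x => rfl
  have h1 : ‖(T : E →L[ℝ] (PiLp ∞ fun _ : Fin k => ℝ))‖ ≤ d :=
    ContinuousLinearMap.opNorm_le_bound _ hd hup
  have h2 : ‖(T.symm : (PiLp ∞ fun _ : Fin k => ℝ) →L[ℝ] E)‖ ≤ 1 := by
    refine ContinuousLinearMap.opNorm_le_bound _ zero_le_one fun y => ?_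
    have := hlow (T.symm y)
    rw [← hT, T.apply_symm_apply] at this
    simpa using this
  have hbdd : BddBelow {c : ℝ | ∃ T : E ≃L[ℝ] (PiLp ∞ fun _ : Fin k => ℝ),
      c = ‖(T : E →L[ℝ] (PiLp ∞ fun _ : Fin k => ℝ))‖ *
        ‖(T.symm : (PiLp ∞ fun _ : Fin k => ℝ) →L[ℝ] E)‖} := by
    refine ⟨0, ?_⟩
    rintro c ⟨S, rfl⟩; positivity
  refine (csInf_le hbdd ⟨T, rfl⟩).trans ?_
  · calc _ ≤ d * 1 := mul_le_mul h1 h2 (norm_nonneg _) hd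
      _ = d := mul_one d

lemma nonempty_set {E : Type*} [NormedAddCommGroup E] [NormedSpace ℝ E] [FiniteDimensional ℝ E]
    (k : ℕ) (hE : Module.finrank ℝ E = k) :
    {c : ℝ | ∃ T : E ≃L[ℝ] (PiLp ∞ fun _ : Fin k => ℝ),
      c = ‖(T : E →L[ℝ] (PiLp ∞ fun _ : Fin k => ℝ))‖ *
        ‖(T.symm : (PiLp ∞ fun _ : Fin k => ℝ) →L[ℝ] E)‖}.Nonempty := by
  have hfr : Module.finrank ℝ E = Module.finrank ℝ (PiLp ∞ fun _ : Fin k => ℝ) := by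
    rw [hE, LinearEquiv.finrank_eq (WithLp.linearEquiv ∞ ℝ (Fin k → ℝ))]; simp
  exact ⟨_, ContinuousLinearEquiv.ofFinrankEq hfr, rfl⟩

/-- The key descent step. -/
lemma PF_step {Z W : Type*} [NormedAddCommGroup Z] [NormedSpace ℝ Z]
    [NormedAddCommGroup W] [NormedSpace ℝ W] (J : Z →ₗ[ℝ] W) (e : W) (k : ℕ) (d : ℝ) (hd : d < 3)
    (h1 : ∀ z (t : ℝ), ‖z‖ ≤ ‖J z + t • e‖)
    (h2 : ∀ z (t : ℝ), |t| ≤ ‖z‖ → ‖J z + t • e‖ ≤ ‖z‖) (h3 : 1 ≤ ‖e‖)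
    (h : PF W (k + 1) d) : PF Z k d := by
  obtain ⟨f, hf1, hf2⟩ := h
  have he : e ≠ 0 := by
    rintro rfl
    simp at h3
    linarith
  obtain ⟨p, hp⟩ := hf2 e he
  have hap : 1 ≤ |f p e| := h3.trans hp
  have hne : f p e ≠ 0 := by
    intro h0; rw [h0] at hap; simp at hap; linarith
  have hb : ∀ i z, |f i (J z)| ≤ (d - |f i e|) * ‖z‖ := by
    intro i z
    have hz := norm_nonneg z
    have hd0 : 0 ≤ d := by
      have := hf1 p e
      by_contra hc
      nlinarith [norm_nonneg e]
    have A : ∀ s : ℝ, |s| ≤ ‖z‖ → |f i (J z) + s * f i e| ≤ d * ‖z‖ := by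
      intro s hs
      have := hf1 i (J z + s • e)
      rw [map_add, map_smul, smul_eq_mul] at this
      exact this.trans (mul_le_mul_of_nonneg_left (h2 z s hs) hd0)
    have A1 := abs_le.1 (A ‖z‖ (by simp))
    have A2 := abs_le.1 (A (-‖z‖) (by simp))
    rw [abs_le]
    rcases abs_cases (f i e) with ⟨hc, _⟩ | ⟨hc, _⟩ <;> rw [hc] <;> constructor <;> nlinarith
  refine ⟨fun i => f (p.succAbove i) ∘ₗ J
    - (f (p.succAbove i) e / (2 * f p e)) • (f p ∘ₗ J), ?_, ?_⟩
  · intro i z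
    simp only [LinearMap.sub_apply, LinearMap.smul_apply, LinearMap.comp_apply, smul_eq_mul]
    set a := f (p.succAbove i) e
    have B1 := hb (p.succAbove i) z
    have B2 := hb p z
    have hz := norm_nonneg z
    refine (abs_sub _ _).trans ?_
    rw [abs_mul, abs_div, abs_mul, abs_two]
    set q := |f p e|
    have hq : 0 < q := by linarith
    have B3 : |f p (J z)| ≤ 2 * q * ‖z‖ := by
      refine B2.trans (mul_le_mul_of_nonneg_right (by linarith) hz)
    have B4 : |a| / (2 * q) * |f p (J z)| ≤ |a| * ‖z‖ := by
      calc _ ≤ |a| / (2 * q) * (2 * q * ‖z‖) := by gcongr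
        _ = |a| * ‖z‖ := by field_simp
    linarith
  · intro z hz
    have hz' : 0 < ‖z‖ := norm_pos_iff.2 hz
    have hw := h1 z (-(f p (J z) / (2 * f p e)))
    have hw0 : J z + (-(f p (J z) / (2 * f p e))) • e ≠ 0 := by
      intro h0; rw [h0, norm_zero] at hw; linarith
    obtain ⟨i, hi⟩ := hf2 _ hw0
    have hi' := hw.trans hi
    rw [map_add, map_smul, smul_eq_mul] at hi'
    rcases Fin.eq_self_or_eq_succAbove p i with rfl | ⟨j, rfl⟩
    · exfalso
      have : f i (J z) + -(f i (J z) / (2 * f i e)) * f i e = f i (J z) / 2 := by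
        field_simp; ring
      rw [this, abs_div, abs_two] at hi'
      have := hb i z
      nlinarith
    · refine ⟨j, hi'.trans (le_of_eq ?_)⟩
      simp only [LinearMap.sub_apply, LinearMap.smul_apply, LinearMap.comp_apply, smul_eq_mul]
      congr 1
      ring

lemma PF_congr {E F : Type*} [NormedAddCommGroup E] [NormedSpace ℝ E]
    [NormedAddCommGroup F] [NormedSpace ℝ F] (e : F →ₗ[ℝ] E) (he : ∀ x, ‖e x‖ = ‖x‖)
    (k : ℕ) (d : ℝ) (h : PF E k d) : PF F k d := by
  obtain ⟨f, hf1, hf2⟩ := h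
  refine ⟨fun i => f i ∘ₗ e, fun i x => ?_, fun x hx => ?_⟩
  · simpa [he] using hf1 i (e x)
  · have : e x ≠ 0 := by
      rw [← norm_ne_zero_iff, he]; exact norm_ne_zero_iff.2 hx
    simpa [he] using hf2 (e x) this

lemma PF_descend {X : Type*} [NormedAddCommGroup X] [NormedSpace ℝ X] (k : ℕ) (d : ℝ)
    (hd : d < 3) : ∀ m : ℕ, PF (X × (Fin m → ℝ)) (k + m) d → PF X k d := by
  intro m
  induction m with
  | zero =>
    intro h
    refine PF_congr (LinearMap.inl ℝ X (Fin 0 → ℝ)) (fun x => ?_) k d h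
    rw [LinearMap.inl_apply, Prod.norm_mk, norm_zero, max_eq_left (norm_nonneg _)]
  | succ m ih =>
    intro h
    apply ih
    let E : (Fin m → ℝ) →ₗ[ℝ] (Fin (m + 1) → ℝ) :=
      LinearMap.pi (Fin.cons 0 (fun i => LinearMap.proj i))
    have key : ∀ (z : X × (Fin m → ℝ)) (t : ℝ), (LinearMap.prodMap LinearMap.id E) z +
        t • ((0, Pi.single 0 1) : X × (Fin (m + 1) → ℝ)) = (z.1, Fin.cons t z.2) := by
      rintro ⟨x, y⟩ t
      refine Prod.ext (by simp) ?_
      funext i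
      refine Fin.cases ?_ (fun j => ?_) i <;> simp [E]
    refine PF_step (LinearMap.prodMap LinearMap.id E) (0, Pi.single 0 1) (k + m) d hd ?_ ?_ ?_ h
    · rintro ⟨x, y⟩ t
      rw [key, Prod.norm_mk, Prod.norm_mk]
      refine max_le_max le_rfl ?_
      refine (pi_norm_le_iff_of_nonneg (norm_nonneg _)).2 fun j => ?_
      simpa using norm_le_pi_norm (Fin.cons t y : Fin (m + 1) → ℝ) j.succ
    · rintro ⟨x, y⟩ t ht
      rw [key]
      refine max_le (norm_fst_le (x, y)) ?_
      refine (pi_norm_le_iff_of_nonneg (norm_nonneg _)).2 fun j => ?_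
      refine Fin.cases ?_ (fun j => ?_) j
      · simpa using ht
      · simpa using (norm_le_pi_norm y j).trans (norm_snd_le (x, y))
    · have := norm_le_pi_norm (Pi.single 0 1 : Fin (m + 1) → ℝ) 0
      rw [Prod.norm_mk]
      refine le_max_of_le_right ?_
      simpa using this

lemma PF_extend {X : Type*} [NormedAddCommGroup X] [NormedSpace ℝ X] (k m : ℕ) (d : ℝ)
    (hd : 1 ≤ d) (h : PF X k d) (hm : 1 ≤ m) : PF (X × (Fin m → ℝ)) (k + m) d := by
  obtain ⟨f, hf1, hf2⟩ := h
  refine ⟨Fin.append (fun i => f i ∘ₗ LinearMap.fst ℝ X (Fin m → ℝ))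
    (fun j => LinearMap.proj j ∘ₗ LinearMap.snd ℝ X (Fin m → ℝ)), fun i => ?_, ?_⟩
  · rintro ⟨x, y⟩
    refine Fin.addCases (fun i => ?_) (fun j => ?_) i
    · simp only [Fin.append_left, LinearMap.comp_apply, LinearMap.fst_apply]
      exact (hf1 i x).trans (mul_le_mul_of_nonneg_left (norm_fst_le (x, y)) (by linarith))
    · simp only [Fin.append_right, LinearMap.comp_apply, LinearMap.snd_apply, LinearMap.proj_apply]
      have := (norm_le_pi_norm y j).trans (norm_snd_le (x, y))
      rw [Real.norm_eq_abs] at this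
      nlinarith [norm_nonneg (x, y)]
  · rintro ⟨x, y⟩ hxy
    have : Nonempty (Fin m) := ⟨⟨0, hm⟩⟩
    obtain ⟨j, hj⟩ := Finite.exists_max (fun j => ‖y j‖)
    have hy : ‖y‖ ≤ ‖y j‖ := (pi_norm_le_iff_of_nonneg (norm_nonneg _)).2 hj
    by_cases hx : x = 0
    · refine ⟨Fin.natAdd k j, ?_⟩
      subst hx
      simpa [Prod.norm_mk] using hy
    · obtain ⟨i, hi⟩ := hf2 x hx
      rcases le_total ‖x‖ ‖y‖ with hc | hc
      · refine ⟨Fin.natAdd k j, ?_⟩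
        rw [Prod.norm_mk, max_eq_right hc]
        simpa using hy
      · refine ⟨Fin.castAdd m i, ?_⟩
        rw [Prod.norm_mk, max_eq_left hc]
        simpa using hi

/-- for an `n`-dimensional normed space `X` with `d_BM(X, ℓ∞ⁿ) ≤ 3`,
`d_BM(X ⊕∞ ℓ∞ᵐ, ℓ∞ⁿ⁺ᵐ) = d_BM(X, ℓ∞ⁿ)`. -/
theorem stmt_9 (n m : ℕ) (hn : 1 ≤ n) (hm : 1 ≤ m)
    (X : Type) [NormedAddCommGroup X] [NormedSpace ℝ X] [FiniteDimensional ℝ X]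
    (hdim : Module.finrank ℝ X = n)
    (h : dBM X (PiLp ∞ fun _ : Fin n => ℝ) ≤ 3) :
    dBM (WithLp ∞ (X × PiLp ∞ fun _ : Fin m => ℝ)) (PiLp ∞ fun _ : Fin (n + m) => ℝ) =
      dBM X (PiLp ∞ fun _ : Fin n => ℝ) := by
  let e : WithLp ∞ (X × PiLp ∞ fun _ : Fin m => ℝ) ≃ₗ[ℝ] X × (Fin m → ℝ) :=
    (WithLp.linearEquiv ∞ ℝ (X × PiLp ∞ fun _ : Fin m => ℝ)).trans
      (LinearEquiv.prodCongr (LinearEquiv.refl ℝ X) (WithLp.linearEquiv ∞ ℝ (Fin m → ℝ)))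
  have he : ∀ x, ‖e x‖ = ‖x‖ := by
    intro x
    rw [WithLp.prod_norm_eq_sup]
    change max ‖x.fst‖ ‖x.snd.ofLp‖ = max ‖x.fst‖ ‖x.snd‖
    rw [PiLp.norm_ofLp]
  have hes : ∀ x, ‖e.symm x‖ = ‖x‖ := fun x => by rw [← he, e.apply_symm_apply]
  have : FiniteDimensional ℝ (WithLp ∞ (X × PiLp ∞ fun _ : Fin m => ℝ)) :=
    LinearEquiv.finiteDimensional e.symm
  have hfr : Module.finrank ℝ (WithLp ∞ (X × PiLp ∞ fun _ : Fin m => ℝ)) = n + m := by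
    rw [e.finrank_eq, Module.finrank_prod, hdim]; simp
  apply le_antisymm
  · refine le_csInf (nonempty_set n hdim) ?_
    rintro c ⟨T, rfl⟩
    have hP := PF_of_equiv n T hn
    set c := ‖(T : X →L[ℝ] (PiLp ∞ fun _ : Fin n => ℝ))‖ *
        ‖(T.symm : (PiLp ∞ fun _ : Fin n => ℝ) →L[ℝ] X)‖
    have hc : 1 ≤ c := by
      obtain ⟨f, hf1, hf2⟩ := hP
      have : Nontrivial X := Module.nontrivial_of_finrank_pos (R := ℝ) (by omega)
      obtain ⟨x, hx⟩ := exists_ne (0 : X)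
      obtain ⟨i, hi⟩ := hf2 x hx
      have h1 := hi.trans (hf1 i x)
      have h2 : 0 < ‖x‖ := norm_pos_iff.2 hx
      by_contra hlt
      nlinarith
    exact dBM_le_of_PF (n + m) c (by linarith) hfr
      (PF_congr e.toLinearMap he _ _ (PF_extend n m c hc hP hm))
  · refine le_csInf (nonempty_set (n + m) hfr) ?_
    rintro c ⟨T, rfl⟩
    rcases le_or_gt 3 (‖(T : WithLp ∞ (X × PiLp ∞ fun _ : Fin m => ℝ) →L[ℝ]
          (PiLp ∞ fun _ : Fin (n + m) => ℝ))‖ *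
        ‖(T.symm : (PiLp ∞ fun _ : Fin (n + m) => ℝ) →L[ℝ]
          WithLp ∞ (X × PiLp ∞ fun _ : Fin m => ℝ))‖) with hc | hc
    · exact h.trans hc
    · exact dBM_le_of_PF n _ (by positivity) hdim
        (PF_descend n _ hc m (PF_congr e.symm.toLinearMap hes _ _
          (PF_of_equiv (n + m) T (by omega))))
end

section
/- Let $n_1, \dots, n_k \ge 1$ be integers, let $X_i$ be an $n_i$-dimensional real normed space, and let $p \in [1,\infty]$. Then $d_{BM}(X_1 \oplus_p \cdots \oplus_p X_k, \ell_2^{n_1+\dots+n_k}) = \|(d_{BM}(X_1, \ell_2^{n_1}), \dots, d_{BM}(X_k, \ell_2^{n_k}))\|_r$, where $r = \frac{2p}{|p-2|}$, with the conventions $r = \infty$ for $p = 2$ and $r = 2$ for $p = \infty$. -/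
open scoped ENNReal

section helpers
variable {k : ℕ}

/-- the `ℓ_q` norm of a real vector. -/
noncomputable def nq (q : ℝ≥0∞) (t : Fin k → ℝ) : ℝ := ‖(WithLp.toLp q t : PiLp q fun _ : Fin k => ℝ)‖

theorem nq_nonneg (q : ℝ≥0∞) [Fact (1 ≤ q)] (t : Fin k → ℝ) : 0 ≤ nq q t := norm_nonneg _

theorem toReal_pos_of (q : ℝ≥0∞) [h : Fact (1 ≤ q)] (hq : q ≠ ∞) : 0 < q.toReal :=
  ENNReal.toReal_pos (zero_lt_one.trans_le h.out).ne' hq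

theorem norm_eq_nq (q : ℝ≥0∞) [Fact (1 ≤ q)] {Y : Fin k → Type} [∀ i, NormedAddCommGroup (Y i)]
    (x : PiLp q Y) : ‖x‖ = nq q (fun i => ‖x i‖) := by
  unfold nq
  by_cases hq : q = ∞
  · subst hq
    simp [PiLp.norm_eq_ciSup]
  · have := toReal_pos_of q hq
    rw [PiLp.norm_eq_sum this, PiLp.norm_eq_sum this]
    simp

theorem nq_eq_sum (q : ℝ≥0∞) [Fact (1 ≤ q)] (hq : q ≠ ∞) (t : Fin k → ℝ) (ht : ∀ i, 0 ≤ t i) :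
    nq q t = (∑ i, t i ^ q.toReal) ^ (1 / q.toReal) := by
  unfold nq
  rw [PiLp.norm_eq_sum (toReal_pos_of q hq)]
  simp [abs_of_nonneg (ht _)]

theorem nq_smul (q : ℝ≥0∞) [Fact (1 ≤ q)] (c : ℝ) (hc : 0 ≤ c) (t : Fin k → ℝ) :
    nq q (fun i => c * t i) = c * nq q t := by
  unfold nq
  have : (WithLp.toLp q (fun i => c * t i) : PiLp q fun _ : Fin k => ℝ) = c • WithLp.toLp q t := by
    ext i; simp
  rw [this, norm_smul, Real.norm_of_nonneg hc]

theorem le_nq (q : ℝ≥0∞) [Fact (1 ≤ q)] (t : Fin k → ℝ) (i : Fin k) : t i ≤ nq q t :=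
  (le_abs_self _).trans (PiLp.norm_apply_le (WithLp.toLp q t : PiLp q fun _ : Fin k => ℝ) i)

theorem nq_top_le (t : Fin k → ℝ) (ht : ∀ i, 0 ≤ t i) (A : ℝ) (hA : 0 ≤ A) (h : ∀ i, t i ≤ A) :
    nq ∞ t ≤ A := by
  unfold nq
  rw [PiLp.norm_toLp, pi_norm_le_iff_of_nonneg hA]
  intro i
  rw [Real.norm_of_nonneg (ht i)]
  exact h i

theorem nq_mono (q : ℝ≥0∞) [Fact (1 ≤ q)] (s t : Fin k → ℝ) (hs : ∀ i, 0 ≤ s i)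
    (h : ∀ i, s i ≤ t i) : nq q s ≤ nq q t := by
  have ht : ∀ i, 0 ≤ t i := fun i => (hs i).trans (h i)
  by_cases hq : q = ∞
  · subst hq
    exact nq_top_le s hs _ (nq_nonneg _ _) (fun i => (h i).trans (le_nq _ t i))
  · have := toReal_pos_of q hq
    rw [nq_eq_sum q hq s hs, nq_eq_sum q hq t ht]
    apply Real.rpow_le_rpow (Finset.sum_nonneg fun i _ => Real.rpow_nonneg (hs i) _)
    · exact Finset.sum_le_sum fun i _ => Real.rpow_le_rpow (hs i) (h i) this.le
    · positivity

theorem nq_anti (q p : ℝ≥0∞) [Fact (1 ≤ q)] [Fact (1 ≤ p)] (hqp : q ≤ p) (t : Fin k → ℝ)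
    (ht : ∀ i, 0 ≤ t i) : nq p t ≤ nq q t := by
  by_cases hp : p = ∞
  · subst hp
    exact nq_top_le t ht _ (nq_nonneg _ _) (fun i => le_nq _ t i)
  have hq : q ≠ ∞ := fun h => hp (top_le_iff.1 (h ▸ hqp))
  have p0 := toReal_pos_of p hp
  have q0 := toReal_pos_of q hq
  have hqp' : q.toReal ≤ p.toReal := ENNReal.toReal_mono hp hqp
  set M := nq q t with hM
  have M0 : 0 ≤ M := nq_nonneg q t
  have hMq : M ^ q.toReal = ∑ i, t i ^ q.toReal := by
    rw [hM, nq_eq_sum q hq t ht, ← Real.rpow_mul (Finset.sum_nonneg fun i _ => Real.rpow_nonneg (ht i) _)]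
    rw [one_div_mul_cancel q0.ne', Real.rpow_one]
  rw [nq_eq_sum p hp t ht]
  have key : ∑ i, t i ^ p.toReal ≤ M ^ p.toReal := by
    have e : ∀ x : ℝ, 0 ≤ x → x ^ p.toReal = x ^ q.toReal * x ^ (p.toReal - q.toReal) := by
      intro x hx
      rw [← Real.rpow_add_of_nonneg hx q0.le (by linarith)]
      congr 1; ring
    rw [e M M0, hMq, Finset.sum_mul]
    apply Finset.sum_le_sum
    intro i _
    rw [e _ (ht i)]
    exact mul_le_mul_of_nonneg_left (Real.rpow_le_rpow (ht i) (le_nq q t i) (by linarith))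
      (Real.rpow_nonneg (ht i) _)
  calc _ ≤ (M ^ p.toReal) ^ (1 / p.toReal) :=
        Real.rpow_le_rpow (Finset.sum_nonneg fun i _ => Real.rpow_nonneg (ht i) _) key (by positivity)
    _ = M := by rw [← Real.rpow_mul M0, mul_one_div_cancel p0.ne', Real.rpow_one]

/-- Hölder relation `1/q = 1/s + 1/r`. -/
def HT (s r q : ℝ≥0∞) : Prop :=
  (r = ∞ ∧ s = q) ∨ (s = ∞ ∧ r = q) ∨
    (s ≠ ∞ ∧ r ≠ ∞ ∧ q ≠ ∞ ∧ Real.HolderTriple s.toReal r.toReal q.toReal)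

theorem nq_holder (s r q : ℝ≥0∞) [Fact (1 ≤ s)] [Fact (1 ≤ r)] [Fact (1 ≤ q)] (h : HT s r q)
    (a t : Fin k → ℝ) (ha : ∀ i, 0 ≤ a i) (ht : ∀ i, 0 ≤ t i) :
    nq q (fun i => a i * t i) ≤ nq r a * nq s t := by
  rcases h with ⟨rfl, rfl⟩ | ⟨rfl, rfl⟩ | ⟨hs, hr, hq, h⟩
  · rw [← nq_smul _ _ (nq_nonneg _ _)]
    exact nq_mono _ _ _ (fun i => mul_nonneg (ha i) (ht i))
      (fun i => mul_le_mul_of_nonneg_right (le_nq _ a i) (ht i))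
  · rw [mul_comm, ← nq_smul _ _ (nq_nonneg _ _)]
    refine nq_mono _ _ _ (fun i => mul_nonneg (ha i) (ht i)) (fun i => ?_)
    rw [mul_comm]
    exact mul_le_mul_of_nonneg_right (le_nq _ t i) (ha i)
  · rw [nq_eq_sum q hq _ (fun i => mul_nonneg (ha i) (ht i)), nq_eq_sum r hr a ha,
      nq_eq_sum s hs t ht]
    lift a to Fin k → NNReal using ha
    lift t to Fin k → NNReal using ht
    have := NNReal.Lr_le_Lp_mul_Lq Finset.univ a t h.symm
    beta_reduce
    exact_mod_cast this

theorem nq_dual (s r q : ℝ≥0∞) [Fact (1 ≤ s)] [Fact (1 ≤ r)] [Fact (1 ≤ q)] (h : HT s r q)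
    (a : Fin k → ℝ) (ha : ∀ i, 0 ≤ a i) (A : ℝ) (hA : 0 ≤ A)
    (H : ∀ t : Fin k → ℝ, (∀ i, 0 ≤ t i) → nq q (fun i => a i * t i) ≤ A * nq s t) :
    nq r a ≤ A := by
  rcases h with ⟨rfl, rfl⟩ | ⟨rfl, rfl⟩ | ⟨hs, hr, hq, h⟩
  · refine nq_top_le a ha A hA (fun i => ?_)
    have := H (Pi.single i 1) (fun j => by by_cases hj : j = i <;> simp [hj])
    have h1 : nq s (Pi.single i 1 : Fin k → ℝ) = 1 := by
      unfold nq
      rw [PiLp.toLp_single, PiLp.norm_single]; simp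
    rw [h1, mul_one] at this
    refine le_trans ?_ this
    refine le_trans ?_ (le_nq s _ i)
    simp
  · have := H (fun _ => 1) (fun _ => zero_le_one)
    simp only [mul_one] at this
    refine this.trans ?_
    have := nq_top_le (k := k) (fun _ => 1) (fun _ => zero_le_one) 1 zero_le_one (fun _ => le_rfl)
    nlinarith
  · have s0 := toReal_pos_of s hs
    have r0 := toReal_pos_of r hr
    have q0 := toReal_pos_of q hq
    have hi := h.inv_add_inv_eq_inv
    have := H (fun i => a i ^ (r.toReal / s.toReal)) (fun i => Real.rpow_nonneg (ha i) _)
    rw [nq_eq_sum q hq _ (fun i => mul_nonneg (ha i) (Real.rpow_nonneg (ha i) _)),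
      nq_eq_sum s hs _ (fun i => Real.rpow_nonneg (ha i) _)] at this
    rw [nq_eq_sum r hr a ha]
    have e1 : ∀ i, (a i * a i ^ (r.toReal / s.toReal)) ^ q.toReal = a i ^ r.toReal := by
      intro i
      have : a i * a i ^ (r.toReal / s.toReal) = a i ^ (1 + r.toReal / s.toReal) := by
        rw [Real.rpow_add_of_nonneg (ha i) (by norm_num) (by positivity), Real.rpow_one]
      rw [this, ← Real.rpow_mul (ha i)]
      congr 1
      field_simp at hi ⊢
      linarith
    have e2 : ∀ i, (a i ^ (r.toReal / s.toReal)) ^ s.toReal = a i ^ r.toReal := by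
      intro i
      rw [← Real.rpow_mul (ha i)]
      congr 1
      field_simp
    simp only [e1, e2] at this
    set S := ∑ i, a i ^ r.toReal with hS
    have S0 : 0 ≤ S := Finset.sum_nonneg fun i _ => Real.rpow_nonneg (ha i) _
    rcases S0.eq_or_lt with h0 | h0
    · rw [← h0, Real.zero_rpow (by positivity)]; exact hA
    · have e3 : S ^ (1 / q.toReal) = S ^ (1 / r.toReal) * S ^ (1 / s.toReal) := by
        rw [← Real.rpow_add h0]
        congr 1
        simp only [one_div]; linarith
      rw [e3] at this
      exact le_of_mul_le_mul_right this (Real.rpow_pos_of_pos h0 _)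
end helpers

theorem HT_of (p r : ℝ≥0∞) (hp : 1 ≤ p)
    (hr : r = if p = ∞ then 2 else 2 * p / ((p - 2) + (2 - p))) :
    1 ≤ r ∧ ((2 ≤ p ∧ HT p r 2) ∨ (p ≤ 2 ∧ HT 2 r p)) := by
  by_cases hpt : p = ∞
  · subst hpt
    simp only [if_true] at hr
    subst hr
    exact ⟨by norm_num, Or.inl ⟨le_top, Or.inr (Or.inl ⟨rfl, rfl⟩)⟩⟩
  rw [if_neg hpt] at hr
  lift p to NNReal using hpt
  have hp1 : (1 : ℝ) ≤ p := by exact_mod_cast hp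
  have h2 : ((2 : NNReal) : ℝ≥0∞) = 2 := rfl
  have h2r : (2 : ℝ≥0∞).toReal = 2 := rfl
  rcases lt_trichotomy p 2 with h | h | h
  · have h' : (p : ℝ) < 2 := by exact_mod_cast h
    have hsub : ((p : ℝ≥0∞) - 2) + (2 - p) = ((2 - p : NNReal) : ℝ≥0∞) := by
      rw [tsub_eq_zero_of_le (by exact_mod_cast h.le), zero_add, ← h2, ENNReal.coe_sub]
    have hne : (2 - p : NNReal) ≠ 0 := (tsub_pos_of_lt h).ne'
    have hr' : r = ((2 * p / (2 - p) : NNReal) : ℝ≥0∞) := by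
      rw [hr, hsub, ENNReal.coe_div hne]; norm_cast
    have hc : ((2 * p / (2 - p) : NNReal) : ℝ) = 2 * p / (2 - p) := by
      rw [NNReal.coe_div, NNReal.coe_mul, NNReal.coe_sub h.le]; rfl
    have hd : (0 : ℝ) < 2 - p := by linarith
    refine ⟨?_, Or.inr ⟨by exact_mod_cast h.le, Or.inr (Or.inr ⟨by simp, by simp [hr'], by simp, ?_⟩)⟩⟩
    · rw [hr']
      have : (1 : ℝ) ≤ ((2 * p / (2 - p) : NNReal) : ℝ) := by
        rw [hc, le_div_iff₀ hd]; linarith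
      exact_mod_cast this
    · rw [hr', ENNReal.coe_toReal, hc, ENNReal.coe_toReal, h2r]
      refine ⟨?_, by norm_num, by positivity⟩
      field_simp
      ring
  · subst h
    have : r = ∞ := by
      rw [hr, h2]; simp [ENNReal.div_zero]
    exact ⟨by simp [this], Or.inl ⟨h2.ge, Or.inl ⟨this, h2⟩⟩⟩
  · have h' : (2 : ℝ) < p := by exact_mod_cast h
    have hsub : ((p : ℝ≥0∞) - 2) + (2 - p) = ((p - 2 : NNReal) : ℝ≥0∞) := by
      rw [tsub_eq_zero_of_le (a := (2 : ℝ≥0∞)) (by exact_mod_cast h.le), add_zero, ← h2, ENNReal.coe_sub]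
    have hne : (p - 2 : NNReal) ≠ 0 := (tsub_pos_of_lt h).ne'
    have hr' : r = ((2 * p / (p - 2) : NNReal) : ℝ≥0∞) := by
      rw [hr, hsub, ENNReal.coe_div hne]; norm_cast
    have hc : ((2 * p / (p - 2) : NNReal) : ℝ) = 2 * p / (p - 2) := by
      rw [NNReal.coe_div, NNReal.coe_mul, NNReal.coe_sub h.le]; rfl
    have hd : (0 : ℝ) < p - 2 := by linarith
    refine ⟨?_, Or.inl ⟨by exact_mod_cast h.le, Or.inr (Or.inr ⟨by simp, by simp [hr'], by simp, ?_⟩)⟩⟩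
    · rw [hr']
      have : (1 : ℝ) ≤ ((2 * p / (p - 2) : NNReal) : ℝ) := by
        rw [hc, le_div_iff₀ hd]; linarith
      exact_mod_cast this
    · rw [hr', ENNReal.coe_toReal, ENNReal.coe_toReal, hc, h2r]
      refine ⟨?_, by positivity, by positivity⟩
      field_simp
      ring

section dist
variable {E F : Type*} [NormedAddCommGroup E] [NormedSpace ℝ E]
    [NormedAddCommGroup F] [NormedSpace ℝ F]

theorem dBM_le_of (T : E ≃L[ℝ] F) (A B : ℝ) (hA : 0 ≤ A) (hB : 0 ≤ B)
    (h1 : ∀ x, ‖T x‖ ≤ A * ‖x‖) (h2 : ∀ x, ‖x‖ ≤ B * ‖T x‖) : dBM E F ≤ A * B := by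
  have hb : BddBelow {c : ℝ | ∃ T : E ≃L[ℝ] F, c = ‖(T : E →L[ℝ] F)‖ * ‖(T.symm : F →L[ℝ] E)‖} :=
    ⟨0, by rintro c ⟨S, rfl⟩; positivity⟩
  refine (csInf_le hb ⟨T, rfl⟩).trans ?_
  refine mul_le_mul ?_ ?_ (norm_nonneg _) hA
  · exact ContinuousLinearMap.opNorm_le_bound _ hA h1
  · refine ContinuousLinearMap.opNorm_le_bound _ hB fun y => ?_
    have := h2 (T.symm y)
    simpa using this

theorem le_dBM_of (T₀ : E ≃L[ℝ] F) (c : ℝ)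
    (h : ∀ T : E ≃L[ℝ] F, c ≤ ‖(T : E →L[ℝ] F)‖ * ‖(T.symm : F →L[ℝ] E)‖) : c ≤ dBM E F := by
  refine le_csInf ⟨_, T₀, rfl⟩ ?_
  rintro b ⟨T, rfl⟩
  exact h T

theorem dBM_nonneg : 0 ≤ dBM E F := by
  refine Real.sInf_nonneg ?_
  rintro c ⟨S, rfl⟩
  positivity

theorem exists_scaled [Nontrivial E] (T₀ : E ≃L[ℝ] F) (α β : ℝ) (hβ : 0 < β)
    (h : dBM E F < α * β) :
    ∃ S : E ≃L[ℝ] F, (∀ x, ‖S x‖ ≤ α * ‖x‖) ∧ (∀ x, ‖x‖ ≤ β * ‖S x‖) := by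
  obtain ⟨c, ⟨T, rfl⟩, hc⟩  := exists_lt_of_csInf_lt
    (s := {c : ℝ | ∃ T : E ≃L[ℝ] F, c = ‖(T : E →L[ℝ] F)‖ * ‖(T.symm : F →L[ℝ] E)‖})
    ⟨_, T₀, rfl⟩ h
  have hpos : 0 < ‖(T.symm : F →L[ℝ] E)‖ := T.norm_symm_pos
  set b := ‖(T.symm : F →L[ℝ] E)‖ with hb
  have hl : 0 < b / β := by positivity
  refine ⟨T.trans (ContinuousLinearEquiv.smulLeft (Units.mk0 (b / β) hl.ne')), fun x => ?_, fun x => ?_⟩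
  · have h1 : ‖T x‖ ≤ ‖(T : E →L[ℝ] F)‖ * ‖x‖ := (T : E →L[ℝ] F).le_opNorm x
    have e : ‖(T.trans (ContinuousLinearEquiv.smulLeft (Units.mk0 (b / β) hl.ne'))) x‖ = b / β * ‖T x‖ := by
      change ‖(b / β) • T x‖ = _
      rw [norm_smul, Real.norm_of_nonneg hl.le]
    rw [e]
    calc b / β * ‖T x‖ ≤ b / β * (‖(T : E →L[ℝ] F)‖ * ‖x‖) := by gcongr
      _ = (‖(T : E →L[ℝ] F)‖ * b) / β * ‖x‖ := by ring
      _ ≤ (α * β) / β * ‖x‖ := by gcongr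
      _ = α * ‖x‖ := by field_simp
  · have e : ‖(T.trans (ContinuousLinearEquiv.smulLeft (Units.mk0 (b / β) hl.ne'))) x‖ = b / β * ‖T x‖ := by
      change ‖(b / β) • T x‖ = _
      rw [norm_smul, Real.norm_of_nonneg hl.le]
    rw [e]
    have h1 : ‖T.symm (T x)‖ ≤ b * ‖T x‖ := (T.symm : F →L[ℝ] E).le_opNorm (T x)
    rw [T.symm_apply_apply] at h1
    refine h1.trans (le_of_eq ?_)
    field_simp

theorem exists_attain [FiniteDimensional ℝ E] [Nontrivial E] (L : E →L[ℝ] F) :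
    ∃ x : E, ‖x‖ = 1 ∧ ‖L x‖ = ‖L‖ := by
  have := FiniteDimensional.proper_real E
  obtain ⟨x, hx, hmax⟩ := (isCompact_sphere (0 : E) 1).exists_isMaxOn
    (NormedSpace.sphere_nonempty.2 zero_le_one) (f := fun x => ‖L x‖) (by fun_prop)
  have hx1 : ‖x‖ = 1 := by simpa using hx
  refine ⟨x, hx1, le_antisymm ?_ ?_⟩
  · simpa [hx1] using L.le_opNorm x
  · refine L.opNorm_le_of_unit_norm (norm_nonneg _) fun y hy => ?_
    exact hmax (by simpa using hy)

end dist

section signs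
variable {H : Type*} [NormedAddCommGroup H] [InnerProductSpace ℝ H] {ι : Type*} [DecidableEq ι]

theorem signs_ge (y : ι → H) (s : Finset ι) : ∃ e : ι → ℝ, (∀ i, e i = 1 ∨ e i = -1) ∧
    ∑ i ∈ s, ‖y i‖ ^ 2 ≤ ‖∑ i ∈ s, e i • y i‖ ^ 2 := by
  induction s using Finset.induction_on with
  | empty => exact ⟨fun _ => 1, fun _ => Or.inl rfl, by simp⟩
  | insert a s has ih =>
    obtain ⟨e, he, h⟩ := ih
    have key : ∀ c : ℝ, ∑ i ∈ insert a s, (Function.update e a c) i • y i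
        = c • y a + ∑ i ∈ s, e i • y i := by
      intro c
      rw [Finset.sum_insert has, Function.update_self]
      congr 1
      refine Finset.sum_congr rfl fun i hi => ?_
      rw [Function.update_of_ne (ne_of_mem_of_not_mem hi has)]
    have hc : ∃ c : ℝ, (c = 1 ∨ c = -1) ∧ 0 ≤ inner ℝ (c • y a) (∑ i ∈ s, e i • y i) := by
      rcases le_total 0 (inner ℝ (y a) (∑ i ∈ s, e i • y i)) with h0 | h0
      · exact ⟨1, Or.inl rfl, by simpa using h0⟩
      · exact ⟨-1, Or.inr rfl, by simpa using h0⟩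
    obtain ⟨c, hc, h0⟩ := hc
    refine ⟨Function.update e a c, fun i => ?_, ?_⟩
    · by_cases hi : i = a
      · subst hi; simpa using hc
      · rw [Function.update_of_ne hi]; exact he i
    · rw [key, Finset.sum_insert has, norm_add_sq_real]
      have : ‖c • y a‖ = ‖y a‖ := by rcases hc with rfl | rfl <;> simp
      rw [this]
      linarith

theorem signs_le (y : ι → H) (s : Finset ι) : ∃ e : ι → ℝ, (∀ i, e i = 1 ∨ e i = -1) ∧
    ‖∑ i ∈ s, e i • y i‖ ^ 2 ≤ ∑ i ∈ s, ‖y i‖ ^ 2 := by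
  induction s using Finset.induction_on with
  | empty => exact ⟨fun _ => 1, fun _ => Or.inl rfl, by simp⟩
  | insert a s has ih =>
    obtain ⟨e, he, h⟩ := ih
    have key : ∀ c : ℝ, ∑ i ∈ insert a s, (Function.update e a c) i • y i
        = c • y a + ∑ i ∈ s, e i • y i := by
      intro c
      rw [Finset.sum_insert has, Function.update_self]
      congr 1
      refine Finset.sum_congr rfl fun i hi => ?_
      rw [Function.update_of_ne (ne_of_mem_of_not_mem hi has)]
    have hc : ∃ c : ℝ, (c = 1 ∨ c = -1) ∧ inner ℝ (c • y a) (∑ i ∈ s, e i • y i) ≤ 0 := by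
      rcases le_total 0 (inner ℝ (y a) (∑ i ∈ s, e i • y i)) with h0 | h0
      · exact ⟨-1, Or.inr rfl, by simpa using h0⟩
      · exact ⟨1, Or.inl rfl, by simpa using h0⟩
    obtain ⟨c, hc, h0⟩ := hc
    refine ⟨Function.update e a c, fun i => ?_, ?_⟩
    · by_cases hi : i = a
      · subst hi; simpa using hc
      · rw [Function.update_of_ne hi]; exact he i
    · rw [key, Finset.sum_insert has, norm_add_sq_real]
      have : ‖c • y a‖ = ‖y a‖ := by rcases hc with rfl | rfl <;> simp
      rw [this]
      linarith
end signs

theorem exists_euclid {E H : Type*} [NormedAddCommGroup E] [NormedSpace ℝ E]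
    [FiniteDimensional ℝ E] [NormedAddCommGroup H] [InnerProductSpace ℝ H] (L : E →ₗ[ℝ] H)
    (hL : Function.Injective L) (m : ℕ) (hm : Module.finrank ℝ E = m) :
    ∃ S : E ≃L[ℝ] EuclideanSpace ℝ (Fin m), ∀ x, ‖S x‖ = ‖L x‖ := by
  have hfr : Module.finrank ℝ (LinearMap.range L) = m := by
    rw [← hm, LinearMap.finrank_range_of_inj hL]
  let b := (stdOrthonormalBasis ℝ (LinearMap.range L)).reindex (finCongr hfr)
  let S := (LinearEquiv.ofInjective L hL).trans b.repr.toLinearEquiv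
  refine ⟨S.toContinuousLinearEquiv, fun x => ?_⟩
  change ‖b.repr (LinearEquiv.ofInjective L hL x)‖ = _
  rw [LinearIsometryEquiv.norm_map]
  rfl

section main
variable {k : ℕ} {X : Fin k → Type} [∀ i, NormedAddCommGroup (X i)] [∀ i, NormedSpace ℝ (X i)]

theorem sum_singles (p : ℝ≥0∞) [Fact (1 ≤ p)] (e : Fin k → ℝ) (x : ∀ i, X i) :
    (WithLp.toLp p (fun i => e i • x i) : PiLp p X) = ∑ i, e i • PiLp.single p i (x i) := by
  ext j
  rw [WithLp.ofLp_sum, Finset.sum_apply, Finset.sum_eq_single j]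
  · simp
  · intro i _ hij
    simp [Pi.single_eq_of_ne hij.symm]
  · simp

theorem nq_two (t : Fin k → ℝ) : nq 2 t ^ 2 = ∑ i, t i ^ 2 := by
  unfold nq
  rw [PiLp.norm_sq_eq_of_L2]
  simp

theorem norm_signed (p : ℝ≥0∞) [Fact (1 ≤ p)] (e : Fin k → ℝ) (he : ∀ i, e i = 1 ∨ e i = -1)
    (x : ∀ i, X i) :
    ‖(WithLp.toLp p (fun i => e i • x i) : PiLp p X)‖ = nq p (fun i => ‖x i‖) := by
  rw [norm_eq_nq]
  congr 1
  funext i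
  rcases he i with h | h <;> simp [h]

theorem pinch_le {H : Type*} [NormedAddCommGroup H] [InnerProductSpace ℝ H]
    (p : ℝ≥0∞) [Fact (1 ≤ p)] (T : PiLp p X ≃L[ℝ] H) (x : ∀ i, X i) :
    nq 2 (fun i => ‖T (PiLp.single p i (x i))‖)
      ≤ ‖(T : PiLp p X →L[ℝ] H)‖ * nq p (fun i => ‖x i‖) := by
  obtain ⟨e, he, h⟩ := signs_ge (fun i => T (PiLp.single p i (x i))) Finset.univ
  have h1 : ∑ i, e i • T (PiLp.single p i (x i)) = T (WithLp.toLp p (fun i => e i • x i)) := by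
    rw [sum_singles, map_sum]; simp
  rw [h1, ← nq_two] at h
  have h2 := (sq_le_sq₀ (nq_nonneg _ _) (norm_nonneg _)).1 h
  refine h2.trans ?_
  rw [← norm_signed p e he x]
  exact (T : PiLp p X →L[ℝ] H).le_opNorm _

theorem pinch_ge {H : Type*} [NormedAddCommGroup H] [InnerProductSpace ℝ H]
    (p : ℝ≥0∞) [Fact (1 ≤ p)] (T : PiLp p X ≃L[ℝ] H) (x : ∀ i, X i) :
    nq p (fun i => ‖x i‖) ≤ ‖(T.symm : H →L[ℝ] PiLp p X)‖ *
      nq 2 (fun i => ‖T (PiLp.single p i (x i))‖) := by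
  obtain ⟨e, he, h⟩ := signs_le (fun i => T (PiLp.single p i (x i))) Finset.univ
  have h1 : ∑ i, e i • T (PiLp.single p i (x i)) = T (WithLp.toLp p (fun i => e i • x i)) := by
    rw [sum_singles, map_sum]; simp
  rw [h1, ← nq_two] at h
  have h2 := (sq_le_sq₀ (norm_nonneg _) (nq_nonneg _ _)).1 h
  rw [← norm_signed p e he x]
  have h3 := (T.symm : H →L[ℝ] PiLp p X).le_opNorm (T (WithLp.toLp p (fun i => e i • x i)))
  rw [ContinuousLinearEquiv.coe_coe, T.symm_apply_apply] at h3
  refine h3.trans ?_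
  gcongr

theorem lower {H : Type*} [NormedAddCommGroup H] [InnerProductSpace ℝ H]
    [∀ i, FiniteDimensional ℝ (X i)] [∀ i, Nontrivial (X i)]
    (n : Fin k → ℕ) (hdim : ∀ i, Module.finrank ℝ (X i) = n i)
    (p r : ℝ≥0∞) [Fact (1 ≤ p)] [Fact (1 ≤ r)]
    (h : (2 ≤ p ∧ HT p r 2) ∨ (p ≤ 2 ∧ HT 2 r p)) (T : PiLp p X ≃L[ℝ] H) :
    nq r (fun i => dBM (X i) (EuclideanSpace ℝ (Fin (n i)))) ≤
      ‖(T : PiLp p X →L[ℝ] H)‖ * ‖(T.symm : H →L[ℝ] PiLp p X)‖ := by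
  have hS : ∀ i, ∃ S : X i ≃L[ℝ] EuclideanSpace ℝ (Fin (n i)),
      ∀ x, ‖S x‖ = ‖T (PiLp.single p i x)‖ := by
    intro i
    let L : X i →ₗ[ℝ] H :=
      { toFun := fun x => T (PiLp.single p i x)
        map_add' := fun x y => by rw [PiLp.single_add, map_add]
        map_smul' := fun c x => by
          have : PiLp.single p i (c • x) = c • PiLp.single p i x := by
            ext j; by_cases hj : j = i
            · subst hj; simp
            · simp [Pi.single_eq_of_ne hj]
          rw [this, map_smul]; rfl }
    refine exists_euclid L ?_ (n i) (hdim i)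
    intro x y hxy
    have := T.injective hxy
    have h2 := congrArg (fun z : PiLp p X => z i) this
    simpa using h2
  choose S hS using hS
  set a : Fin k → ℝ := fun i => ‖(S i : X i →L[ℝ] EuclideanSpace ℝ (Fin (n i)))‖ with ha
  set b : Fin k → ℝ := fun i => ‖((S i).symm : EuclideanSpace ℝ (Fin (n i)) →L[ℝ] X i)‖ with hb
  set A := ‖(T : PiLp p X →L[ℝ] H)‖
  set B := ‖(T.symm : H →L[ℝ] PiLp p X)‖
  have a0 : ∀ i, 0 ≤ a i := fun i => norm_nonneg _
  have b0 : ∀ i, 0 ≤ b i := fun i => norm_nonneg _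
  have A0 : 0 ≤ A := norm_nonneg _
  have B0 : 0 ≤ B := norm_nonneg _
  have hd : ∀ i, dBM (X i) (EuclideanSpace ℝ (Fin (n i))) ≤ a i * b i := by
    intro i
    refine dBM_le_of (S i) _ _ (a0 i) (b0 i) (fun x => ?_) (fun x => ?_)
    · exact (S i : X i →L[ℝ] EuclideanSpace ℝ (Fin (n i))).le_opNorm x
    · simpa using ((S i).symm : EuclideanSpace ℝ (Fin (n i)) →L[ℝ] X i).le_opNorm (S i x)
  have HA : ∀ t : Fin k → ℝ, (∀ i, 0 ≤ t i) → nq 2 (fun i => a i * t i) ≤ A * nq p t := by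
    intro t ht
    have hx : ∀ i, ∃ x : X i, ‖x‖ = 1 ∧ ‖S i x‖ = a i := fun i =>
      exists_attain (S i : X i →L[ℝ] EuclideanSpace ℝ (Fin (n i)))
    choose x hx1 hx2 using hx
    have := pinch_le p T (fun i => t i • x i)
    simpa [← hS, norm_smul, hx1, hx2, abs_of_nonneg (ht _), mul_comm (a _)] using this
  have HB : ∀ t : Fin k → ℝ, (∀ i, 0 ≤ t i) → nq p (fun i => b i * t i) ≤ B * nq 2 t := by
    intro t ht
    have hy : ∀ i, ∃ y : EuclideanSpace ℝ (Fin (n i)), ‖y‖ = 1 ∧ ‖(S i).symm y‖ = b i := fun i => by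
      have : Nontrivial (EuclideanSpace ℝ (Fin (n i))) := (S i).injective.nontrivial
      exact exists_attain ((S i).symm : EuclideanSpace ℝ (Fin (n i)) →L[ℝ] X i)
    choose y hy1 hy2 using hy
    have := pinch_ge p T (fun i => t i • (S i).symm (y i))
    simpa [← hS, norm_smul, hy1, hy2, abs_of_nonneg (ht _), mul_comm (b _)] using this
  have d0 : ∀ i, 0 ≤ dBM (X i) (EuclideanSpace ℝ (Fin (n i))) := fun i => dBM_nonneg
  refine (nq_mono r _ _ d0 hd).trans ?_
  have single1 : ∀ (q : ℝ≥0∞) [Fact (1 ≤ q)] (i : Fin k), nq q (Pi.single i 1 : Fin k → ℝ) = 1 := by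
    intro q _ i
    unfold nq
    rw [PiLp.toLp_single, PiLp.norm_single]; simp
  have single0 : ∀ (i j : Fin k), (0 : ℝ) ≤ (Pi.single i 1 : Fin k → ℝ) j := by
    intro i j
    by_cases hj : j = i <;> simp [hj]
  rcases h with ⟨hp, h⟩ | ⟨hp, h⟩
  · have hA := nq_dual p r 2 h a a0 A A0 HA
    have hB : ∀ i, b i ≤ B := by
      intro i
      have := HB (Pi.single i 1) (single0 i)
      rw [single1, mul_one] at this
      refine le_trans ?_ ((le_nq p _ i).trans this)
      simp
    calc nq r (fun i => a i * b i) ≤ nq r (fun i => B * a i) :=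
          nq_mono _ _ _ (fun i => mul_nonneg (a0 i) (b0 i)) (fun i => by
            rw [mul_comm B]; exact mul_le_mul_of_nonneg_left (hB i) (a0 i))
      _ = B * nq r a := nq_smul _ _ B0 _
      _ ≤ A * B := by rw [mul_comm A]; gcongr
  · have hB := nq_dual 2 r p h b b0 B B0 HB
    have hA : ∀ i, a i ≤ A := by
      intro i
      have := HA (Pi.single i 1) (single0 i)
      rw [single1, mul_one] at this
      refine le_trans ?_ ((le_nq 2 _ i).trans this)
      simp
    calc nq r (fun i => a i * b i) ≤ nq r (fun i => A * b i) :=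
          nq_mono _ _ _ (fun i => mul_nonneg (a0 i) (b0 i)) (fun i =>
            mul_le_mul_of_nonneg_right (hA i) (b0 i))
      _ = A * nq r b := nq_smul _ _ A0 _
      _ ≤ A * B := by gcongr

theorem upper_aux [∀ i, FiniteDimensional ℝ (X i)] [∀ i, Nontrivial (X i)]
    (n : Fin k → ℕ) (hdim : ∀ i, Module.finrank ℝ (X i) = n i)
    (p r : ℝ≥0∞) [Fact (1 ≤ p)] [Fact (1 ≤ r)]
    (h : (2 ≤ p ∧ HT p r 2) ∨ (p ≤ 2 ∧ HT 2 r p)) (c : Fin k → ℝ)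
    (hc : ∀ i, dBM (X i) (EuclideanSpace ℝ (Fin (n i))) < c i) :
    dBM (PiLp p X) (EuclideanSpace ℝ (Fin (∑ i, n i))) ≤ nq r c := by
  have c0 : ∀ i, 0 < c i := fun i => dBM_nonneg.trans_lt (hc i)
  have T₀ : ∀ i, X i ≃L[ℝ] EuclideanSpace ℝ (Fin (n i)) := fun i =>
    ContinuousLinearEquiv.ofFinrankEq (by rw [hdim i, finrank_euclideanSpace_fin])
  -- the Euclidean target
  let G := PiLp 2 (fun i : Fin k => EuclideanSpace ℝ (Fin (n i)))
  have hG : Module.finrank ℝ G = ∑ i, n i := by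
    rw [(WithLp.linearEquiv 2 ℝ (∀ i : Fin k, EuclideanSpace ℝ (Fin (n i)))).finrank_eq,
      Module.finrank_pi_fintype]
    simp
  let J : G ≃ₗᵢ[ℝ] EuclideanSpace ℝ (Fin (∑ i, n i)) :=
    ((stdOrthonormalBasis ℝ G).reindex (finCongr hG)).repr
  have build : ∀ (S : ∀ i, X i ≃L[ℝ] EuclideanSpace ℝ (Fin (n i))),
      ∃ T : PiLp p X ≃L[ℝ] EuclideanSpace ℝ (Fin (∑ i, n i)),
        ∀ x, ‖T x‖ = nq 2 (fun i => ‖S i (x i)‖) := by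
    intro S
    let T : PiLp p X ≃ₗ[ℝ] EuclideanSpace ℝ (Fin (∑ i, n i)) :=
      (WithLp.linearEquiv p ℝ (∀ i, X i)).trans
        ((LinearEquiv.piCongrRight (fun i => (S i).toLinearEquiv)).trans
          ((WithLp.linearEquiv 2 ℝ (∀ i : Fin k, EuclideanSpace ℝ (Fin (n i)))).symm.trans
            J.toLinearEquiv))
    refine ⟨T.toContinuousLinearEquiv, fun x => ?_⟩
    change ‖J (WithLp.toLp 2 (fun i => S i (x i)))‖ = _
    rw [J.norm_map, norm_eq_nq]
  rcases h with ⟨hp, h⟩ | ⟨hp, h⟩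
  · have hS : ∀ i, ∃ S : X i ≃L[ℝ] EuclideanSpace ℝ (Fin (n i)),
        (∀ x, ‖S x‖ ≤ c i * ‖x‖) ∧ (∀ x, ‖x‖ ≤ 1 * ‖S x‖) := fun i =>
      exists_scaled (T₀ i) (c i) 1 one_pos (by simpa using hc i)
    choose S hS1 hS2 using hS
    obtain ⟨T, hT⟩ := build S
    rw [← mul_one (nq r c)]
    refine dBM_le_of T _ _ (nq_nonneg _ _) zero_le_one (fun x => ?_) (fun x => ?_)
    · rw [hT, norm_eq_nq]
      exact (nq_mono 2 _ _ (fun i => norm_nonneg _) (fun i => hS1 i (x i))).trans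
        (nq_holder p r 2 h c _ (fun i => (c0 i).le) (fun i => norm_nonneg _))
    · rw [hT, norm_eq_nq, one_mul]
      refine (nq_mono p _ _ (fun i => norm_nonneg _) (fun i => hS2 i (x i))).trans ?_
      simp only [one_mul]
      exact nq_anti 2 p hp _ (fun i => norm_nonneg _)
  · have hS : ∀ i, ∃ S : X i ≃L[ℝ] EuclideanSpace ℝ (Fin (n i)),
        (∀ x, ‖S x‖ ≤ 1 * ‖x‖) ∧ (∀ x, ‖x‖ ≤ c i * ‖S x‖) := fun i =>
      exists_scaled (T₀ i) 1 (c i) (c0 i) (by simpa using hc i)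
    choose S hS1 hS2 using hS
    obtain ⟨T, hT⟩ := build S
    rw [← one_mul (nq r c)]
    refine dBM_le_of T _ _ zero_le_one (nq_nonneg _ _) (fun x => ?_) (fun x => ?_)
    · rw [hT, norm_eq_nq, one_mul]
      refine (nq_mono 2 _ _ (fun i => norm_nonneg _) (fun i => hS1 i (x i))).trans ?_
      simp only [one_mul]
      exact nq_anti p 2 hp _ (fun i => norm_nonneg _)
    · rw [hT, norm_eq_nq]
      exact (nq_mono p _ _ (fun i => norm_nonneg _) (fun i => hS2 i (x i))).trans
        (nq_holder 2 r p h c _ (fun i => (c0 i).le) (fun i => norm_nonneg _))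

theorem nq_add (q : ℝ≥0∞) [Fact (1 ≤ q)] (s t : Fin k → ℝ) :
    nq q (fun i => s i + t i) ≤ nq q s + nq q t := by
  unfold nq
  exact norm_add_le (WithLp.toLp q s : PiLp q fun _ : Fin k => ℝ) (WithLp.toLp q t)

theorem upper [∀ i, FiniteDimensional ℝ (X i)] [∀ i, Nontrivial (X i)]
    (n : Fin k → ℕ) (hdim : ∀ i, Module.finrank ℝ (X i) = n i)
    (p r : ℝ≥0∞) [Fact (1 ≤ p)] [Fact (1 ≤ r)]
    (h : (2 ≤ p ∧ HT p r 2) ∨ (p ≤ 2 ∧ HT 2 r p)) :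
    dBM (PiLp p X) (EuclideanSpace ℝ (Fin (∑ i, n i))) ≤
      nq r (fun i => dBM (X i) (EuclideanSpace ℝ (Fin (n i)))) := by
  refine le_of_forall_pos_le_add fun ε hε => ?_
  set M := nq r (fun _ : Fin k => (1 : ℝ)) with hM
  have M0 : 0 ≤ M := nq_nonneg _ _
  set δ := ε / (M + 1) with hδ
  have δ0 : 0 < δ := by positivity
  refine (upper_aux n hdim p r h
    (fun i => dBM (X i) (EuclideanSpace ℝ (Fin (n i))) + δ * 1) (fun i => by linarith)).trans ?_
  refine (nq_add r _ _).trans ?_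
  rw [nq_smul r δ δ0.le, ← hM]
  have : δ * M ≤ ε := by
    rw [hδ, div_mul_eq_mul_div, div_le_iff₀ (by positivity)]
    nlinarith
  linarith
end main

/-- the Banach–Mazur distance of an `ℓ_p`-sum to Euclidean space is the
`ℓ_r`-norm of the vector of the distances of the summands to Euclidean space,
where `r = 2p/|p-2|` (with `r = ∞` for `p = 2` and `r = 2` for `p = ∞`). -/
theorem stmt_10 (k : ℕ) (hk : 1 ≤ k) (n : Fin k → ℕ) (hn : ∀ i, 1 ≤ n i)
    (X : Fin k → Type) [∀ i, NormedAddCommGroup (X i)] [∀ i, NormedSpace ℝ (X i)]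
    [∀ i, FiniteDimensional ℝ (X i)] (hdim : ∀ i, Module.finrank ℝ (X i) = n i)
    (p : ℝ≥0∞) (hp : 1 ≤ p) [Fact (1 ≤ p)] (r : ℝ≥0∞)
    (hr : r = if p = ∞ then 2 else 2 * p / ((p - 2) + (2 - p))) :
    dBM (PiLp p X) (EuclideanSpace ℝ (Fin (∑ i, n i))) =
      ‖(WithLp.equiv r (Fin k → ℝ)).symm
        (fun i => dBM (X i) (EuclideanSpace ℝ (Fin (n i))))‖ := by

  obtain ⟨hr1, h⟩ := HT_of p r hp hr
  have : Fact (1 ≤ r) := ⟨hr1⟩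
  have : ∀ i, Nontrivial (X i) := fun i =>
    Module.nontrivial_of_finrank_pos (R := ℝ) (by rw [hdim i]; exact hn i)
  change _ = nq r (fun i => dBM (X i) (EuclideanSpace ℝ (Fin (n i))))
  refine le_antisymm (upper n hdim p r h) ?_
  refine le_dBM_of ?_ _ (fun T => lower n hdim p r h T)
  refine ContinuousLinearEquiv.ofFinrankEq ?_
  rw [(WithLp.linearEquiv p ℝ (∀ i, X i)).finrank_eq, Module.finrank_pi_fintype]
  simp [hdim]
end

section
/- For any integer $n \ge 1$ and any $p \in (1, 2]$ with conjugate exponent $p^* = \frac{p}{p-1}$, the Banach–Mazur distance from the $p^*$-sum of $n$ copies of $\ell_p^n$ to Euclidean space satisfies $d_{BM}(\ell_p^n \oplus_{p^*} \cdots \oplus_{p^*} \ell_p^n, \ell_2^{n^2}) = n^{\frac{2-p}{p}}$. -/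
open scoped ENNReal

theorem aux_M1 {n : ℕ} (a : Fin n → ℝ) (ha : ∀ i, 0 ≤ a i) (r t : ℝ) (hr : 0 < r) (hrt : r ≤ t) :
    (∑ i, a i ^ t) ^ (1 / t) ≤ (∑ i, a i ^ r) ^ (1 / r) := by
  have ht : 0 < t := hr.trans_le hrt
  set s := ∑ i, a i ^ r with hs
  have hs0 : 0 ≤ s := Finset.sum_nonneg fun i _ => Real.rpow_nonneg (ha i) _
  have hle : ∀ i, a i ≤ s ^ (1 / r) := by
    intro i
    have h1 : a i ^ r ≤ s := Finset.single_le_sum (f := fun i => a i ^ r)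
      (fun i _ => Real.rpow_nonneg (ha i) _) (Finset.mem_univ i)
    have h2 := Real.rpow_le_rpow (Real.rpow_nonneg (ha i) _) h1 (by positivity : 0 ≤ 1 / r)
    rwa [← Real.rpow_mul (ha i), mul_one_div_cancel hr.ne', Real.rpow_one] at h2
  have key : ∑ i, a i ^ t ≤ s * (s ^ (1 / r)) ^ (t - r) := by
    rw [hs, Finset.sum_mul]
    refine Finset.sum_le_sum fun i _ => ?_
    have : a i ^ t = a i ^ r * a i ^ (t - r) := by
      rw [← Real.rpow_add_of_nonneg (ha i) hr.le (by linarith)]; congr 1; ring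
    rw [this]
    exact mul_le_mul_of_nonneg_left (Real.rpow_le_rpow (ha i) (hle i) (by linarith))
      (Real.rpow_nonneg (ha i) _)
  have e : s * (s ^ (1 / r)) ^ (t - r) = (s ^ (1 / r)) ^ t := by
    have : s = (s ^ (1 / r)) ^ r := by
      rw [← Real.rpow_mul hs0, one_div_mul_cancel hr.ne', Real.rpow_one]
    conv_lhs => lhs; rw [this]
    rw [← Real.rpow_add_of_nonneg (Real.rpow_nonneg hs0 _) hr.le (by linarith)]
    congr 1; ring
  rw [e] at key
  have h3 := Real.rpow_le_rpow (Finset.sum_nonneg fun i _ => Real.rpow_nonneg (ha i) _) key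
    (by positivity : 0 ≤ 1 / t)
  rwa [← Real.rpow_mul (Real.rpow_nonneg hs0 _) t, mul_one_div_cancel ht.ne', Real.rpow_one] at h3

theorem aux_M2 {n : ℕ} (a : Fin n → ℝ) (ha : ∀ i, 0 ≤ a i) (r t : ℝ) (hr : 0 < r) (hrt : r ≤ t) :
    (∑ i, a i ^ r) ^ (1 / r) ≤ (n : ℝ) ^ (1 / r - 1 / t) * (∑ i, a i ^ t) ^ (1 / t) := by
  have ht : 0 < t := hr.trans_le hrt
  have h := Real.rpow_sum_le_const_mul_sum_rpow (s := Finset.univ) (f := fun i => a i ^ r)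
    (p := t / r) (by rwa [one_le_div hr])
  have e : ∀ i, |a i ^ r| = a i ^ r := fun i => abs_of_nonneg (Real.rpow_nonneg (ha i) _)
  have e2 : ∀ i, (a i ^ r) ^ (t / r) = a i ^ t := by
    intro i
    rw [← Real.rpow_mul (ha i)]; congr 1; field_simp
  simp only [e, e2, Finset.card_univ, Fintype.card_fin] at h
  have hs0 : 0 ≤ ∑ i, a i ^ r := Finset.sum_nonneg fun i _ => Real.rpow_nonneg (ha i) _
  have ht0 : 0 ≤ ∑ i, a i ^ t := Finset.sum_nonneg fun i _ => Real.rpow_nonneg (ha i) _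
  have h3 := Real.rpow_le_rpow (Real.rpow_nonneg hs0 _) h (by positivity : 0 ≤ 1 / t)
  rw [← Real.rpow_mul hs0, Real.mul_rpow (by positivity) ht0, ← Real.rpow_mul (by positivity)] at h3
  convert h3 using 3
  · field_simp
  · field_simp

theorem aux_signs_ge {ι F : Type*} [NormedAddCommGroup F] [InnerProductSpace ℝ F]
    [DecidableEq ι] (s : Finset ι) (v : ι → F) :
    ∃ ε : ι → ℝ, (∀ i, |ε i| = 1) ∧ ∑ i ∈ s, ‖v i‖ ^ 2 ≤ ‖∑ i ∈ s, ε i • v i‖ ^ 2 := by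
  induction s using Finset.induction_on with
  | empty => exact ⟨fun _ => 1, by simp, by simp⟩
  | insert a s has ih =>
    obtain ⟨ε, h1, h2⟩ := ih
    have key : ∀ c : ℝ, ∑ i ∈ insert a s, Function.update ε a c i • v i
        = c • v a + ∑ i ∈ s, ε i • v i := by
      intro c
      rw [Finset.sum_insert has]
      congr 1
      · simp
      · refine Finset.sum_congr rfl fun i hi => ?_
        rw [Function.update_of_ne (by rintro rfl; exact has hi)]
    have hc : ∀ c : ℝ, |c| = 1 → ∀ i, |Function.update ε a c i| = 1 := by
      intro c hc i
      by_cases h : i = a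
      · subst h; simpa using hc
      · rw [Function.update_of_ne h]; exact h1 i
    rcases le_total 0 (inner ℝ (v a) (∑ i ∈ s, ε i • v i)) with h | h
    · refine ⟨_, hc 1 (by simp), ?_⟩
      rw [key, Finset.sum_insert has, one_smul, norm_add_sq_real]
      linarith
    · refine ⟨_, hc (-1) (by simp), ?_⟩
      rw [key, Finset.sum_insert has, norm_add_sq_real, inner_smul_left, norm_smul]
      simp
      linarith

theorem aux_signs_le {ι F : Type*} [NormedAddCommGroup F] [InnerProductSpace ℝ F]
    [DecidableEq ι] (s : Finset ι) (v : ι → F) :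
    ∃ ε : ι → ℝ, (∀ i, |ε i| = 1) ∧ ‖∑ i ∈ s, ε i • v i‖ ^ 2 ≤ ∑ i ∈ s, ‖v i‖ ^ 2 := by
  induction s using Finset.induction_on with
  | empty => exact ⟨fun _ => 1, by simp, by simp⟩
  | insert a s has ih =>
    obtain ⟨ε, h1, h2⟩ := ih
    have key : ∀ c : ℝ, ∑ i ∈ insert a s, Function.update ε a c i • v i
        = c • v a + ∑ i ∈ s, ε i • v i := by
      intro c
      rw [Finset.sum_insert has]
      congr 1
      · simp
      · refine Finset.sum_congr rfl fun i hi => ?_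
        rw [Function.update_of_ne (by rintro rfl; exact has hi)]
    have hc : ∀ c : ℝ, |c| = 1 → ∀ i, |Function.update ε a c i| = 1 := by
      intro c hc i
      by_cases h : i = a
      · subst h; simpa using hc
      · rw [Function.update_of_ne h]; exact h1 i
    rcases le_total 0 (inner ℝ (v a) (∑ i ∈ s, ε i • v i)) with h | h
    · refine ⟨_, hc (-1) (by simp), ?_⟩
      rw [key, Finset.sum_insert has, norm_add_sq_real, inner_smul_left, norm_smul]
      simp
      linarith
    · refine ⟨_, hc 1 (by simp), ?_⟩
      rw [key, Finset.sum_insert has, one_smul, norm_add_sq_real]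
      linarith

/-- The coordinate identification of the double sum with Euclidean space. -/
noncomputable def auxEquiv (n : ℕ) (P Q : ℝ≥0∞) :
    PiLp Q (fun _ : Fin n => PiLp P (fun _ : Fin n => ℝ)) ≃ₗ[ℝ]
      EuclideanSpace ℝ (Fin n × Fin n) where
  toFun x := WithLp.toLp 2 fun k => x k.1 k.2
  invFun y := WithLp.toLp Q fun i => WithLp.toLp P fun j => y (i, j)
  map_add' _ _ := rfl
  map_smul' _ _ := rfl
  left_inv _ := rfl
  right_inv _ := rfl

theorem aux_norm_eq {n : ℕ} (P : ℝ) (hP : 0 < P) [Fact (1 ≤ ENNReal.ofReal P)]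
    {E : Type*} [NormedAddCommGroup E] (x : PiLp (ENNReal.ofReal P) (fun _ : Fin n => E)) :
    ‖x‖ = (∑ i, ‖x i‖ ^ P) ^ (1 / P) := by
  have h : (ENNReal.ofReal P).toReal = P := ENNReal.toReal_ofReal hP.le
  rw [PiLp.norm_eq_sum (by rw [h]; exact hP), h]

theorem aux_sum_apply {n : ℕ} (P Q : ℝ≥0∞) {ι : Type*} (s : Finset ι)
    (f : ι → PiLp Q (fun _ : Fin n => PiLp P (fun _ : Fin n => ℝ))) (i j : Fin n) :
    (∑ k ∈ s, f k) i j = ∑ k ∈ s, f k i j := by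
  classical
  induction s using Finset.induction_on with
  | empty => rfl
  | insert a s has ih => rw [Finset.sum_insert has, Finset.sum_insert has, ← ih]; rfl

theorem aux_upgrade {E F : Type*} [NormedAddCommGroup E] [NormedSpace ℝ E]
    [NormedAddCommGroup F] [NormedSpace ℝ F] [FiniteDimensional ℝ F] (L : E ≃ₗ[ℝ] F) :
    ∃ T : E ≃L[ℝ] F, ∀ x, T x = L x := by
  have : FiniteDimensional ℝ E := Module.Finite.equiv L.symm
  exact ⟨L.toContinuousLinearEquiv, fun _ => rfl⟩

theorem aux_exists (n : ℕ) (P Q : ℝ≥0∞) [Fact (1 ≤ P)] [Fact (1 ≤ Q)] :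
    ∃ T : PiLp Q (fun _ : Fin n => PiLp P (fun _ : Fin n => ℝ)) ≃L[ℝ]
      EuclideanSpace ℝ (Fin (n ^ 2)), ∀ x, ‖T x‖ =
        (∑ i, ((∑ j, ‖x i j‖ ^ (2:ℝ)) ^ (1 / (2:ℝ))) ^ (2:ℝ)) ^ (1 / (2:ℝ)) := by
  let e : (Fin n × Fin n) ≃ Fin (n ^ 2) :=
    finProdFinEquiv.trans (finCongr (by ring))
  let U : EuclideanSpace ℝ (Fin n × Fin n) ≃ₗᵢ[ℝ] EuclideanSpace ℝ (Fin (n ^ 2)) :=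
    LinearIsometryEquiv.piLpCongrLeft 2 ℝ ℝ e
  obtain ⟨T, hT⟩ := aux_upgrade (auxEquiv n P Q)
  refine ⟨T.trans U.toContinuousLinearEquiv, fun x => ?_⟩
  have hTn : ‖(T.trans U.toContinuousLinearEquiv) x‖ = ‖auxEquiv n P Q x‖ := by
    rw [← hT]; exact U.norm_map _
  rw [hTn, EuclideanSpace.norm_eq, Real.sqrt_eq_rpow, Fintype.sum_prod_type]
  congr 1
  refine Finset.sum_congr rfl fun i _ => ?_
  rw [← Real.rpow_mul (by positivity)]
  simp [auxEquiv]
  rfl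

theorem stmt_11 (n : ℕ) (hn : 1 ≤ n) (p : ℝ) (hp1 : 1 < p) (hp2 : p ≤ 2)
    [Fact (1 ≤ ENNReal.ofReal p)] [Fact (1 ≤ ENNReal.ofReal (p / (p - 1)))] :
    dBM (PiLp (ENNReal.ofReal (p / (p - 1)))
          (fun _ : Fin n => PiLp (ENNReal.ofReal p) (fun _ : Fin n => ℝ)))
        (EuclideanSpace ℝ (Fin (n ^ 2))) = (n : ℝ) ^ ((2 - p) / p) := by
  have hp0 : 0 < p := by linarith
  have hn0 : (0 : ℝ) < n := by exact_mod_cast hn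
  set q := p / (p - 1) with hq
  have hq0 : 0 < q := div_pos hp0 (by linarith)
  have hq2 : 2 ≤ q := by rw [hq, le_div_iff₀ (by linarith)]; linarith
  have hqp : 1 / q = 1 - 1 / p := by
    rw [hq]; have : p - 1 ≠ 0 := by linarith
    field_simp
  have hexp : (2 - p) / p = 1 / p - 1 / q := by rw [hqp]; field_simp; ring
  have lower : ∀ T : PiLp (ENNReal.ofReal q)
          (fun _ : Fin n => PiLp (ENNReal.ofReal p) (fun _ : Fin n => ℝ)) ≃L[ℝ]
        EuclideanSpace ℝ (Fin (n ^ 2)), (n : ℝ) ^ ((2 - p) / p) ≤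
          ‖(T : (PiLp (ENNReal.ofReal q)
            (fun _ : Fin n => PiLp (ENNReal.ofReal p) (fun _ : Fin n => ℝ))) →L[ℝ] EuclideanSpace ℝ (Fin (n ^ 2)))‖ *
          ‖(T.symm : EuclideanSpace ℝ (Fin (n ^ 2)) →L[ℝ] (PiLp (ENNReal.ofReal q)
            (fun _ : Fin n => PiLp (ENNReal.ofReal p) (fun _ : Fin n => ℝ))))‖ := by
    intro T
    set a := ‖(T : (PiLp (ENNReal.ofReal q)
            (fun _ : Fin n => PiLp (ENNReal.ofReal p) (fun _ : Fin n => ℝ))) →L[ℝ] EuclideanSpace ℝ (Fin (n ^ 2)))‖ with ha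
    set b := ‖(T.symm : EuclideanSpace ℝ (Fin (n ^ 2)) →L[ℝ] (PiLp (ENNReal.ofReal q)
            (fun _ : Fin n => PiLp (ENNReal.ofReal p) (fun _ : Fin n => ℝ))))‖ with hb
    have ha0 : 0 ≤ a := norm_nonneg _
    have hb0 : 0 ≤ b := norm_nonneg _
    have hTa : ∀ x, ‖T x‖ ≤ a * ‖x‖ := fun x => (T : (PiLp (ENNReal.ofReal q)
            (fun _ : Fin n => PiLp (ENNReal.ofReal p) (fun _ : Fin n => ℝ))) →L[ℝ] EuclideanSpace ℝ (Fin (n ^ 2))).le_opNorm x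
    have hTb : ∀ x, ‖x‖ ≤ b * ‖T x‖ := fun x => by
      simpa using (T.symm : EuclideanSpace ℝ (Fin (n ^ 2)) →L[ℝ] (PiLp (ENNReal.ofReal q)
            (fun _ : Fin n => PiLp (ENNReal.ofReal p) (fun _ : Fin n => ℝ)))).le_opNorm (T x)
    let e : Fin n → Fin n → PiLp (ENNReal.ofReal q)
          (fun _ : Fin n => PiLp (ENNReal.ofReal p) (fun _ : Fin n => ℝ)) := fun i j =>
      WithLp.toLp _ (Pi.single i (WithLp.toLp _ (Pi.single j 1)))
    have hcol : ∀ j, ∑ i, ‖T (e i j)‖ ^ 2 ≤ (a * (n : ℝ) ^ (1 / q)) ^ 2 := by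
      intro j
      obtain ⟨ε, h1, h2⟩ := aux_signs_ge Finset.univ fun i => T (e i j)
      refine h2.trans ?_
      simp_rw [← map_smul, ← map_sum]
      gcongr
      refine (hTa _).trans (le_of_eq ?_)
      congr 1
      have hx : ∀ i', (∑ i, ε i • e i j) i' = WithLp.toLp _ (Pi.single j (ε i')) := by
        intro i'
        ext j'
        rw [aux_sum_apply]
        simp only [e, PiLp.smul_apply]
        rw [Finset.sum_eq_single i']
        · by_cases h : j' = j
          · subst h; simp
          · simp [h]
        · intro k _ hk
          rw [Pi.single_eq_of_ne hk.symm]; simp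
        · simp
      rw [aux_norm_eq q hq0]
      have hN : ∀ i', ‖(∑ i, ε i • e i j) i'‖ = 1 := by
        intro i'
        rw [hx, aux_norm_eq p hp0]
        simp [Pi.single_apply, apply_ite, h1, hp0.ne']
      simp only [hN]
      simp
    have hrow : ∀ i, ((n : ℝ) ^ (1 / p)) ^ 2 ≤ b ^ 2 * ∑ j, ‖T (e i j)‖ ^ 2 := by
      intro i
      obtain ⟨ε, h1, h2⟩ := aux_signs_le Finset.univ fun j => T (e i j)
      refine le_trans ?_ (mul_le_mul_of_nonneg_left h2 (by positivity))
      simp_rw [← map_smul, ← map_sum]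
      rw [← mul_pow]
      gcongr
      refine le_trans (le_of_eq ?_) (hTb _)
      have hx : ∑ j, ε j • e i j = WithLp.toLp _ (Pi.single i (WithLp.toLp _ ε)) := by
        ext i' j'
        rw [aux_sum_apply]
        simp only [e, PiLp.smul_apply]
        by_cases h : i' = i
        · subst h
          simp [Pi.single_apply]
        · simp only [Pi.single_eq_of_ne h]
          simp
      rw [hx, PiLp.norm_toLp_single, aux_norm_eq p hp0]
      simp [h1]
    have hS1 := Finset.sum_le_sum fun j (_ : j ∈ Finset.univ) => hcol j
    have hS2 := Finset.sum_le_sum fun i (_ : i ∈ Finset.univ) => hrow i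
    rw [Finset.sum_comm] at hS1
    rw [← Finset.mul_sum] at hS2
    simp only [Finset.sum_const, Finset.card_univ, Fintype.card_fin, nsmul_eq_mul] at hS1 hS2
    have h5 := hS2.trans (mul_le_mul_of_nonneg_left hS1 (by positivity : 0 ≤ b ^ 2))
    have h6 : ((n : ℝ) ^ (1 / p)) ^ 2 ≤ (a * b * (n : ℝ) ^ (1 / q)) ^ 2 := by
      refine le_of_mul_le_mul_left (h5.trans (le_of_eq ?_)) hn0
      ring
    have h7 := (sq_le_sq₀ (by positivity) (by positivity)).1 h6
    rw [hexp, Real.rpow_sub hn0, div_le_iff₀ (by positivity)]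
    exact h7
  refine le_antisymm ?_ (le_csInf ?_ ?_)
  · obtain ⟨T, hTn2⟩ := aux_exists n (ENNReal.ofReal p) (ENNReal.ofReal q)
    refine csInf_le_of_le ⟨(n : ℝ) ^ ((2 - p) / p), ?_⟩ ⟨T, rfl⟩ ?_
    · rintro c ⟨T, rfl⟩
      exact lower T
    have hA : ‖(T : (PiLp (ENNReal.ofReal q)
            (fun _ : Fin n => PiLp (ENNReal.ofReal p) (fun _ : Fin n => ℝ))) →L[ℝ] EuclideanSpace ℝ (Fin (n ^ 2)))‖ ≤ (n : ℝ) ^ (1 / 2 - 1 / q) := by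
      refine ContinuousLinearMap.opNorm_le_bound _ (by positivity) fun x => ?_
      change ‖T x‖ ≤ _
      rw [hTn2, aux_norm_eq q hq0]
      refine le_trans ?_ (aux_M2 _ (fun i => norm_nonneg _) 2 q (by norm_num) hq2)
      gcongr with i
      rw [aux_norm_eq p hp0]
      exact aux_M1 _ (fun j => norm_nonneg _) p 2 hp0 hp2
    have hB : ‖(T.symm : EuclideanSpace ℝ (Fin (n ^ 2)) →L[ℝ] (PiLp (ENNReal.ofReal q)
            (fun _ : Fin n => PiLp (ENNReal.ofReal p) (fun _ : Fin n => ℝ))))‖ ≤ (n : ℝ) ^ (1 / p - 1 / 2) := by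
      refine ContinuousLinearMap.opNorm_le_bound _ (by positivity) fun y => ?_
      obtain ⟨x, rfl⟩ := T.surjective y
      simp only [ContinuousLinearEquiv.coe_coe, ContinuousLinearEquiv.symm_apply_apply]
      rw [hTn2, aux_norm_eq q hq0]
      refine (aux_M1 _ (fun i => norm_nonneg _) 2 q (by norm_num) hq2).trans ?_
      have h8 : ∀ i, ‖x i‖ ^ (2:ℝ) ≤ ((n : ℝ) ^ (1 / p - 1 / 2)) ^ (2:ℝ) *
          ((∑ j, ‖x i j‖ ^ (2:ℝ)) ^ (1 / (2:ℝ))) ^ (2:ℝ) := by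
        intro i
        rw [← Real.mul_rpow (by positivity) (by positivity)]
        gcongr
        rw [aux_norm_eq p hp0]
        exact aux_M2 _ (fun j => norm_nonneg _) p 2 hp0 hp2
      calc (∑ i, ‖x i‖ ^ (2:ℝ)) ^ (1 / (2:ℝ)) ≤ (∑ i, ((n : ℝ) ^ (1 / p - 1 / 2)) ^ (2:ℝ) *
          ((∑ j, ‖x i j‖ ^ (2:ℝ)) ^ (1 / (2:ℝ))) ^ (2:ℝ)) ^ (1 / (2:ℝ)) := by
            gcongr with i; exact h8 i
        _ = _ := by
          rw [← Finset.mul_sum, Real.mul_rpow (by positivity) (by positivity),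
            ← Real.rpow_mul (by positivity) 2]
          norm_num
    refine (mul_le_mul hA hB (norm_nonneg _) (by positivity)).trans (le_of_eq ?_)
    rw [← Real.rpow_add hn0, hexp]
    congr 1; ring
  · obtain ⟨T, hTn2⟩ := aux_exists n (ENNReal.ofReal p) (ENNReal.ofReal q)
    exact ⟨_, T, rfl⟩
  · rintro c ⟨T, rfl⟩
    exact lower T
end

section
/- Let $n, m \ge 1$ and let $B \subseteq \mathbb{R}^{n+m}$ be an $n$-dimensional convex body with $d_{BM}(B, \Delta^n) \le 2$, where $\Delta^n$ is the $n$-dimensional simplex. Let $v^1, \dots, v^m \in \mathbb{R}^{n+m}$ be vectors such that $C = \mathrm{conv}(B \cup \{v^1, \dots, v^m\})$ is an $(n+m)$-dimensional convex body. Then $d_{BM}(C, \Delta^{n+m}) = d_{BM}(B, \Delta^n)$. -/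
open scoped Pointwise

/-- The Banach–Mazur distance between convex bodies `K ⊆ E` and `L ⊆ F` (of the same
dimension, possibly lower than that of the ambient spaces): the infimum of `ρ ≥ 0` such
that `K + u ⊆ T(L) ⊆ ρ(K + u)` for some affine map `T : F → E` (absorbing the
translation of `L`) and a translation `u`. -/
noncomputable def dBMSet {E F : Type*} [AddCommGroup E] [Module ℝ E]
    [AddCommGroup F] [Module ℝ F] (K : Set E) (L : Set F) : ℝ :=
  sInf {ρ : ℝ | 0 ≤ ρ ∧ ∃ (T : F →ᵃ[ℝ] E) (u : E),
    (· + u) '' K ⊆ T '' L ∧ T '' L ⊆ ρ • ((· + u) '' K)}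

set_option maxHeartbeats 1000000 in
theorem aux_numeric {ι : Type*} [Fintype ι] [DecidableEq ι] (hcard : ∀ i : ι, ∃ j : ι, j ≠ i) [Nonempty ι]
    (θ c v : ι → ℝ) (η : ℝ) (hη0 : 0 ≤ η) (hη : η ≤ 1 / 2)
    (hθ0 : ∀ i, 0 ≤ θ i) (hθ1 : ∀ i, θ i ≤ 1) (hc : ∀ i, 0 ≤ c i) (hv : ∀ i, 0 ≤ v i)
    (hcs : ∑ i, c i = 1) (hvs : ∑ i, v i = 1)
    (hb : ∀ i k, i ≠ k → θ i * v k ≤ η * c k)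
    (hf : ∑ i, v i * θ i = η * (∑ i, c i * θ i) + (1 - η)) :
    ∃ (o : ι) (ε : ι → ℝ), (∀ k, k ≠ o → θ k < θ o) ∧ (∀ k, 0 ≤ ε k) ∧
      0 < θ o - η * (∑ i, c i * θ i) ∧
      (∑ k, (θ o - θ k) * ε k ≤ η * (θ o - η * (∑ i, c i * θ i))) ∧
      (∀ i k, i ≠ o → i ≠ k → η * c k - θ i * v k ≤ ε k * (1 - θ i)) := by
  obtain ⟨o, -, ho⟩ := Finset.exists_max_image Finset.univ θ Finset.univ_nonempty
  obtain ⟨j0, hj0⟩ := hcard o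
  obtain ⟨j, hj, hjm⟩ := Finset.exists_max_image (Finset.univ.erase o) θ ⟨j0, by simp [hj0]⟩
  have hjo : j ≠ o := by simpa using hj
  have hjm' : ∀ k, k ≠ o → θ k ≤ θ j := fun k hk => hjm k (by simp [hk])
  have ho' : ∀ k, θ k ≤ θ o := fun k => ho k (Finset.mem_univ _)
  set t := θ o with ht
  set s := θ j with hs
  set Θ := ∑ i, c i * θ i with hΘ
  have hs0 : 0 ≤ s := hθ0 j
  have hst : s ≤ t := ho' j
  have ht1 : t ≤ 1 := hθ1 o
  have hvo := hv o
  set X := ∑ k ∈ Finset.univ.erase o, v k * θ k with hX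
  have e1 : v o * t + X = η * Θ + (1 - η) := by
    rw [← hf, ← Finset.add_sum_erase Finset.univ _ (Finset.mem_univ o)]
  have e2 : v o + ∑ k ∈ Finset.univ.erase o, v k = 1 := by
    rw [← hvs, ← Finset.add_sum_erase Finset.univ _ (Finset.mem_univ o)]
  have e3 : X ≤ (1 - v o) * s := by
    rw [← e2, add_sub_cancel_left, Finset.sum_mul]
    refine Finset.sum_le_sum fun k hk => mul_le_mul_of_nonneg_left (hjm k hk) (hv k)
  have X0 : 0 ≤ X := Finset.sum_nonneg fun k _ => mul_nonneg (hv k) (hθ0 k)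
  have e4 : s * v o * t + t * X ≤ η * Θ := by
    have : η * Θ = η * c o * t + ∑ k ∈ Finset.univ.erase o, η * c k * θ k := by
      rw [hΘ, ← Finset.add_sum_erase Finset.univ _ (Finset.mem_univ o), mul_add, Finset.mul_sum]
      congr 1
      · ring
      · exact Finset.sum_congr rfl fun k _ => by ring
    rw [this, hX, Finset.mul_sum]
    refine add_le_add (mul_le_mul_of_nonneg_right (hb j o hjo) (hθ0 o)) ?_
    refine Finset.sum_le_sum fun k hk => ?_
    have := mul_le_mul_of_nonneg_right (hb o k (Ne.symm (by simpa using hk))) (hθ0 k)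
    linarith
  have hvo1 : v o ≤ 1 := by
    have : 0 ≤ ∑ k ∈ Finset.univ.erase o, v k := Finset.sum_nonneg fun k _ => hv k
    linarith
  have hΘt : Θ ≤ t := by
    calc Θ ≤ ∑ i, c i * t := Finset.sum_le_sum fun k _ => mul_le_mul_of_nonneg_left (ho' k) (hc k)
      _ = t := by rw [← Finset.sum_mul, hcs, one_mul]
  have hΘ0 : 0 ≤ Θ := Finset.sum_nonneg fun k _ => mul_nonneg (hc k) (hθ0 k)
  have e5 : 1 - η ≤ v o * t * (1 - s) + X * (1 - t) := by nlinarith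
  have e6 : s * (1 - t) ≤ t * (1 - s) := by nlinarith
  have e7 : 1 - η ≤ t * (1 - s) := by
    have h1 : X * (1 - t) ≤ (1 - v o) * s * (1 - t) :=
      mul_le_mul_of_nonneg_right e3 (by linarith)
    have h2 : (1 - v o) * (s * (1 - t)) ≤ (1 - v o) * (t * (1 - s)) :=
      mul_le_mul_of_nonneg_left e6 (by linarith)
    nlinarith
  have hslt : s < t := by
    rcases hst.lt_or_eq with h | h
    · exact h
    · rw [h] at e7
      nlinarith [sq_nonneg (t - 1 / 2)]
  have hs1 : s < 1 := by linarith
  have htpos : 0 < t := by linarith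
  set Z := v o * s + X with hZ
  have hZ0 : 0 ≤ Z := by positivity
  have e8 : s * (1 - η) ≤ Z * (t * (1 - s)) := by
    have h1 := mul_le_mul_of_nonneg_left e5 hs0
    have h2 := mul_le_mul_of_nonneg_left e6 X0
    nlinarith
  have e9 : s * (1 - t) ≤ Z * (1 - η) * (1 - s) := by
    have h1 := mul_le_mul_of_nonneg_left e8 (show 0 ≤ 1 - η by linarith)
    have h2 : t * (1 - t) ≤ (1 - η) * (1 - η) := by nlinarith [sq_nonneg (t - 1 / 2)]
    have h3 := mul_le_mul_of_nonneg_left h2 hs0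
    have h4 : t * (s * (1 - t)) ≤ t * (Z * (1 - η) * (1 - s)) := by nlinarith
    exact le_of_mul_le_mul_left h4 htpos
  have e10 : s * (1 - t) * (t - η * Θ) ≤ (1 - η) * (1 - s) * (η * Θ) := by
    have hY : t * Z ≤ η * Θ := by rw [hZ]; linarith
    have h1 : 0 ≤ s * (1 - t) * (η * Θ) :=
      mul_nonneg (mul_nonneg hs0 (by linarith)) (mul_nonneg hη0 hΘ0)
    have h2 := mul_le_mul_of_nonneg_left e9 htpos.le
    have h3 : (1 - η) * (1 - s) * (t * Z) ≤ (1 - η) * (1 - s) * (η * Θ) :=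
      mul_le_mul_of_nonneg_left hY (mul_nonneg (by linarith) (by linarith))
    nlinarith
  have hApos : 0 < t - η * Θ := by nlinarith
  have s1 : 0 < 1 - s := by linarith
  refine ⟨o, fun k => η * c k + max (η * c k - v k) 0 * (s / (1 - s)),
    fun k hk => (hjm' k hk).trans_lt hslt, fun k => ?_, hApos, ?_, ?_⟩
  · have := hc k
    positivity
  · have t1 : ∑ k, (t - θ k) * max (η * c k - v k) 0 ≤ (1 - t) * (t - η * Θ) := by
      have u1 : ∀ k, (t - θ k) * max (η * c k - v k) 0 ≤
          (t - θ k) * (η * c k - v k) + (1 - t) * ((t - θ k) * v k) := by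
        intro k
        by_cases hk : k = o
        · subst hk; simp [← ht]
        · have hh := hb o k (Ne.symm hk)
          have : max (η * c k - v k) 0 ≤ (η * c k - v k) + (1 - t) * v k := by
            apply max_le
            · nlinarith [hv k]
            · nlinarith [hv k]
          have := mul_le_mul_of_nonneg_left this (sub_nonneg.2 (ho' k))
          linarith
      have u2 : ∑ k, ((t - θ k) * (η * c k - v k) + (1 - t) * ((t - θ k) * v k))
          = t * η * (∑ k, c k) - t * (∑ k, v k) - η * Θ + (∑ k, v k * θ k)
            + (1 - t) * (t * (∑ k, v k) - ∑ k, v k * θ k) := by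
        rw [hΘ]
        simp only [Finset.mul_sum, ← Finset.sum_sub_distrib, ← Finset.sum_add_distrib]
        exact Finset.sum_congr rfl fun k _ => by ring
      calc _ ≤ _ := Finset.sum_le_sum fun k _ => u1 k
        _ = _ := u2
        _ ≤ _ := by rw [hcs, hvs, hf]; nlinarith
    have t2 : ∑ k, (t - θ k) * (η * c k + max (η * c k - v k) 0 * (s / (1 - s)))
        = η * (t * (∑ k, c k) - Θ) + (∑ k, (t - θ k) * max (η * c k - v k) 0) * (s / (1 - s)) := by
      rw [hΘ]
      simp only [Finset.mul_sum, Finset.sum_mul, ← Finset.sum_sub_distrib, ← Finset.sum_add_distrib]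
      exact Finset.sum_congr rfl fun k _ => by ring
    rw [t2, hcs]
    have t3 : (∑ k, (t - θ k) * max (η * c k - v k) 0) * (s / (1 - s)) ≤ (1 - η) * (η * Θ) := by
      rw [← mul_div_assoc, div_le_iff₀ s1]
      have := mul_le_mul_of_nonneg_right t1 hs0
      nlinarith
    linarith
  · intro i k hi hik
    have hi' := hjm' i hi
    have h1 : 0 < 1 - θ i := by linarith
    have h2 : θ i / (1 - θ i) ≤ s / (1 - s) := by
      rw [div_le_div_iff₀ h1 s1]; nlinarith
    have h3 : (η * c k - v k) * (θ i / (1 - θ i)) ≤ max (η * c k - v k) 0 * (s / (1 - s)) :=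
      mul_le_mul (le_max_left _ _) h2 (div_nonneg (hθ0 i) h1.le) (le_max_right _ _)
    have h4 := mul_le_mul_of_nonneg_right h3 h1.le
    have h5 : (η * c k - v k) * (θ i / (1 - θ i)) * (1 - θ i) = (η * c k - v k) * θ i := by
      field_simp
    rw [h5] at h4
    nlinarith

theorem aux_sep {E : Type*} [NormedAddCommGroup E] [NormedSpace ℝ E] {ι : Type*} [Fintype ι]
    [Nonempty ι] {B : Set E} (hB : Convex ℝ B) (hBc : IsClosed B) (r : ι → E) (w : ι → ℝ)
    (β : ι → ι → ℝ) (hβ1 : ∀ i, ∑ k, β i k = 1) (hβB : ∀ i, ∑ k, β i k • r k ∈ B)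
    (hβw : ∀ i k, i ≠ k → β i k ≤ w k) (l : ι → ℝ) (hl1 : ∑ k, l k = 1) (hlw : ∀ k, w k ≤ l k) :
    ∑ k, l k • r k ∈ B := by
  by_contra hy
  obtain ⟨h, u, h1, h2⟩ := geometric_hahn_banach_closed_point hB hBc hy
  obtain ⟨o, -, ho⟩ := Finset.exists_max_image Finset.univ (fun k => h (r k)) Finset.univ_nonempty
  have h3 := h1 _ (hβB o)
  have h4 : h (∑ k, l k • r k) - h (∑ k, β o k • r k) ≤ 0 := by
    have : h (∑ k, l k • r k) - h (∑ k, β o k • r k)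
        = ∑ k, (l k - β o k) * (h (r k) - h (r o)) := by
      have : ∑ k, (l k - β o k) * (h (r k) - h (r o)) = ∑ k, l k * h (r k) - ∑ k, β o k * h (r k)
          - ((∑ k, l k) - ∑ k, β o k) * h (r o) := by
        simp only [Finset.sum_mul, sub_mul, mul_sub, Finset.sum_sub_distrib]
      rw [this, hl1, hβ1]
      simp
    rw [this]
    refine Finset.sum_nonpos fun k _ => ?_
    by_cases hk : o = k
    · subst hk; simp
    · exact mul_nonpos_of_nonneg_of_nonpos (by linarith [hβw o k hk, hlw k])
        (by linarith [ho k (Finset.mem_univ _)])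
  linarith

theorem aux_functional {E : Type*} [AddCommGroup E] [Module ℝ E] (S : Set E) (p : E)
    (hp : p ∉ affineSpan ℝ S) : ∃ f : E →ᵃ[ℝ] ℝ, (∀ x ∈ S, f x = 0) ∧ f p = 1 := by
  rcases S.eq_empty_or_nonempty with rfl | ⟨b, hb⟩
  · exact ⟨AffineMap.const ℝ E 1, by simp, by simp⟩
  have h1 : p - b ∉ vectorSpan ℝ S := by
    intro h
    apply hp
    have := AffineSubspace.vadd_mem_of_mem_direction
      (by rwa [direction_affineSpan] : p - b ∈ (affineSpan ℝ S).direction) (mem_affineSpan ℝ hb)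
    simpa using this
  obtain ⟨g, hg, hk⟩ := Submodule.exists_le_ker_of_notMem h1
  refine ⟨((g (p - b))⁻¹ • g).toAffineMap - AffineMap.const ℝ E ((g (p - b))⁻¹ * g b), ?_, ?_⟩
  · intro x hx
    have : g (x - b) = 0 := hk (vsub_mem_vectorSpan ℝ hx hb)
    rw [map_sub, sub_eq_zero] at this
    simp [this]
  · simp only [AffineMap.coe_sub, LinearMap.coe_toAffineMap, Pi.sub_apply, LinearMap.smul_apply,
      smul_eq_mul, AffineMap.const_apply, ← mul_sub, ← map_sub]
    exact inv_mul_cancel₀ hg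

theorem aux_affine_sum {E F : Type*} [AddCommGroup E] [Module ℝ E] [AddCommGroup F] [Module ℝ F]
    {ι : Type*} [Fintype ι] (f : E →ᵃ[ℝ] F) (s : ι → E) (w : ι → ℝ) (hw : ∑ i, w i = 1) :
    f (∑ i, w i • s i) = ∑ i, w i • f (s i) := by
  rw [← Finset.affineCombination_eq_linear_combination _ _ _ hw,
    Finset.map_affineCombination _ _ _ hw, Finset.affineCombination_eq_linear_combination _ _ _ hw]
  rfl

theorem aux_coords {E : Type*} [AddCommGroup E] [Module ℝ E] {ι : Type*} [Fintype ι]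
    [DecidableEq ι] (s : ι → E) (hs : AffineIndependent ℝ s) :
    ∃ x : ι → (E →ᵃ[ℝ] ℝ), (∀ i j, x i (s j) = if i = j then 1 else 0) ∧
      (∀ y ∈ affineSpan ℝ (Set.range s), ∑ i, x i y = 1 ∧ y = ∑ i, x i y • s i) := by
  have : ∀ i, ∃ f : E →ᵃ[ℝ] ℝ, (∀ y ∈ s '' (Set.univ \ {i}), f y = 0) ∧ f (s i) = 1 := fun i =>
    aux_functional _ _ (hs.notMem_affineSpan_sdiff i Set.univ)
  choose x hx0 hx1 using this
  have hx : ∀ i j, x i (s j) = if i = j then 1 else 0 := by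
    intro i j
    split_ifs with h
    · rw [← h, hx1]
    · exact hx0 i _ ⟨j, by simp [Ne.symm h], rfl⟩
  refine ⟨x, hx, fun y hy => ?_⟩
  obtain ⟨w, hw, rfl⟩ := eq_affineCombination_of_mem_affineSpan_of_fintype hy
  rw [Finset.affineCombination_eq_linear_combination _ _ _ hw]
  have : ∀ i, x i (∑ j, w j • s j) = w i := by
    intro i
    rw [aux_affine_sum _ _ _ hw]
    simp [hx]
  simp [this, hw]
/-- Simplex form of the set of ratios whose infimum is the Banach–Mazur distance. -/
def DS {E : Type*} [AddCommGroup E] [Module ℝ E] (K : Set E) (k : ℕ) : Set ℝ :=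
  {ρ | 0 ≤ ρ ∧ ∃ (s : Fin (k + 1) → E) (u : E),
    (· + u) '' K ⊆ convexHull ℝ (Set.range s) ∧ convexHull ℝ (Set.range s) ⊆ ρ • ((· + u) '' K)}

theorem dBM_eq {E : Type*} [AddCommGroup E] [Module ℝ E] (K : Set E) (n : ℕ)
    (w : Fin (n + 1) → (Fin n → ℝ)) (hw : AffineIndependent ℝ w) :
    dBMSet K (convexHull ℝ (Set.range w)) = sInf (DS K n) := by
  unfold dBMSet DS
  congr 1
  ext ρ
  refine and_congr_right fun _ => ⟨?_, ?_⟩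
  · rintro ⟨T, u, h1, h2⟩
    rw [AffineMap.image_convexHull, ← Set.range_comp] at h1 h2
    exact ⟨T ∘ w, u, h1, h2⟩
  · rintro ⟨s, u, h1, h2⟩
    obtain ⟨x, hx, -⟩ := aux_coords w hw
    let T : (Fin n → ℝ) →ᵃ[ℝ] E :=
      ∑ i, ((LinearMap.toSpanSingleton ℝ E (s i)).toAffineMap.comp (x i))
    have hT : T ∘ w = s := by
      funext j
      have : ∀ (S : Finset (Fin (n + 1))), (∑ i ∈ S,
          ((LinearMap.toSpanSingleton ℝ E (s i)).toAffineMap.comp (x i))) (w j)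
          = ∑ i ∈ S, x i (w j) • s i := by
        intro S
        induction S using Finset.induction_on with
        | empty => simp
        | insert a S ha ih => rw [Finset.sum_insert ha, Finset.sum_insert ha, ← ih]; simp
      simp only [T, Function.comp]
      rw [this]
      simp [hx]
    refine ⟨T, u, ?_⟩
    rw [AffineMap.image_convexHull, ← Set.range_comp, hT]
    exact ⟨h1, h2⟩

theorem aux_conv_map {E F : Type*} [AddCommGroup E] [Module ℝ E] [AddCommGroup F] [Module ℝ F]
    {ι : Type*} (f : E →ᵃ[ℝ] F) (s : ι → E) (A : Set F) (hA : Convex ℝ A)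
    (h : ∀ i, f (s i) ∈ A) (y : E) (hy : y ∈ convexHull ℝ (Set.range s)) : f y ∈ A := by
  have h1 : convexHull ℝ (Set.range s) ⊆ f ⁻¹' A :=
    convexHull_min (Set.range_subset_iff.2 h) (hA.affine_preimage f)
  exact h1 hy

theorem aux_conv_sub {E : Type*} [AddCommGroup E] [Module ℝ E]
    {ι : Type*} (s : ι → E) (u y : E) (hy : y ∈ convexHull ℝ (Set.range s)) :
    y - u ∈ convexHull ℝ (Set.range fun i => s i - u) := by
  have := aux_conv_map (AffineMap.id ℝ E - AffineMap.const ℝ E u) s _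
    (convex_convexHull ℝ (Set.range fun i => s i - u))
    (fun i => subset_convexHull ℝ _ ⟨i, by simp⟩) y hy
  simpa using this

theorem aux_convex_img {E : Type*} [AddCommGroup E] [Module ℝ E] {B : Set E} (hB : Convex ℝ B)
    (u : E) (ρ : ℝ) : Convex ℝ (ρ • ((· + u) '' B)) := by
  have : (· + u) '' B = (fun x => u + x) '' B := by simp only [add_comm]
  rw [this]
  exact (hB.translate u).smul ρ

theorem aux_final {E : Type*} [AddCommGroup E] [Module ℝ E] {B : Set E} (hB : Convex ℝ B) (n : ℕ)
    (r : Fin (n + 1) → E) (hr : B ⊆ convexHull ℝ (Set.range r)) (σ : ℝ) (z : E)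
    (hσ1 : σ < 1) (hz : ∀ i, σ • z + (1 - σ) • r i ∈ B) : 1 / (1 - σ) ∈ DS B n := by
  have h1 : 0 < 1 - σ := by linarith
  refine ⟨by positivity, fun i => r i - z, -z, ?_, ?_⟩
  · rintro _ ⟨y, hy, rfl⟩
    simpa [sub_eq_add_neg] using aux_conv_sub r z y (hr hy)
  · refine convexHull_min (Set.range_subset_iff.2 fun i => ?_) (aux_convex_img hB _ _)
    refine ⟨_, ⟨_, hz i, rfl⟩, ?_⟩
    have h2 : (1 - σ) ≠ 0 := h1.ne'
    simp only [smul_add, smul_smul]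
    have e1 : 1 / (1 - σ) * (1 - σ) = 1 := by field_simp
    have e2 : 1 / (1 - σ) * σ = 1 / (1 - σ) - 1 := by field_simp; ring
    rw [e1, e2]
    module

theorem aux_mem_insert {E : Type*} [AddCommGroup E] [Module ℝ E] {B : Set E} (hB : Convex ℝ B)
    (hne : B.Nonempty) (v p : E) (hp : p ∈ convexHull ℝ (insert v B)) :
    ∃ (θ : ℝ) (b : E), 0 ≤ θ ∧ θ ≤ 1 ∧ b ∈ B ∧ p = θ • v + (1 - θ) • b := by
  rw [convexHull_insert hne, hB.convexHull_eq] at hp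
  obtain ⟨a, ha, b, hb, θ, τ, h1, h2, h3, rfl⟩ := mem_convexJoin.1 hp
  obtain rfl : a = v := ha
  exact ⟨θ, b, h1, by linarith, hb, by rw [← h3]; simp⟩

theorem aux_aff2 {E : Type*} [AddCommGroup E] [Module ℝ E] (f : E →ᵃ[ℝ] ℝ) (a : ℝ) (p q : E) :
    f (a • p + (1 - a) • q) = a * f p + (1 - a) * f q := by
  have := Convex.combo_affine_apply (f := f) (x := p) (y := q) (a := a) (b := 1 - a) (by ring)
  simpa using this

theorem aux_core {E : Type*} [NormedAddCommGroup E] [NormedSpace ℝ E] [FiniteDimensional ℝ E]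
    {B : Set E} (hB : Convex ℝ B) (hBc : IsCompact B) (hne : B.Nonempty) (n : ℕ)
    (v : E) (hv : v ∉ affineSpan ℝ B)
    (hdim : Module.finrank ℝ (vectorSpan ℝ (insert v B)) = n + 1)
    (s : Fin (n + 1 + 1) → E) (hCs : convexHull ℝ (insert v B) ⊆ convexHull ℝ (Set.range s))
    (c : E) (hc : c ∈ convexHull ℝ (insert v B)) (η : ℝ) (hη0 : 0 ≤ η) (hη : η ≤ 1 / 2)
    (hp : ∀ i, η • c + (1 - η) • s i ∈ convexHull ℝ (insert v B)) :
    ∃ ρ ∈ DS B n, ρ ≤ 1 / (1 - η) := by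
  have hsub : insert v B ⊆ convexHull ℝ (Set.range s) := (subset_convexHull ℝ _).trans hCs
  have hind : AffineIndependent ℝ s := by
    rw [affineIndependent_iff_le_finrank_vectorSpan ℝ s (n := n + 1) (by simp)]
    refine hdim.symm.le.trans ?_
    apply Submodule.finrank_mono
    rw [← direction_affineSpan, ← direction_affineSpan ℝ (Set.range s)]
    apply AffineSubspace.direction_le
    rw [affineSpan_le]
    exact hsub.trans (convexHull_subset_affineSpan _)
  obtain ⟨x, hx, hxs⟩ := aux_coords s hind
  have hx0 : ∀ k, ∀ y ∈ convexHull ℝ (Set.range s), 0 ≤ x k y := fun k y hy =>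
    aux_conv_map (x k) s (Set.Ici 0) (convex_Ici 0)
      (fun i => by rw [hx, Set.mem_Ici]; split_ifs <;> norm_num) y hy
  have hxs' : ∀ y ∈ convexHull ℝ (Set.range s), ∑ i, x i y = 1 ∧ y = ∑ i, x i y • s i :=
    fun y hy => hxs y (convexHull_subset_affineSpan _ hy)
  obtain ⟨f, hf0, hf1⟩ := aux_functional B v hv
  have hfx : ∀ y ∈ convexHull ℝ (Set.range s), f y = ∑ i, x i y * f (s i) := by
    intro y hy
    conv_lhs => rw [(hxs' y hy).2, aux_affine_sum _ _ _ (hxs' y hy).1]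
    simp
  choose θ b hθ0 hθ1 hbB hpb using fun i => aux_mem_insert hB hne v _ (hp i)
  have hvs : v ∈ convexHull ℝ (Set.range s) := hsub (Set.mem_insert _ _)
  have hBs : ∀ y ∈ B, y ∈ convexHull ℝ (Set.range s) := fun y hy => hsub (Set.mem_insert_of_mem _ hy)
  have hcs := hCs hc
  have hxp : ∀ i k, η * x k c + (1 - η) * (if k = i then 1 else 0) =
      θ i * x k v + (1 - θ i) * x k (b i) := by
    intro i k
    rw [← hx k i, ← aux_aff2, hpb, aux_aff2]
  have hfp : ∀ i, η * f c + (1 - η) * f (s i) = θ i := by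
    intro i
    rw [← aux_aff2, hpb, aux_aff2, hf1, hf0 _ (hbB i)]; ring
  have hθy : ∀ y ∈ convexHull ℝ (Set.range s), ∑ i, x i y * θ i = η * f c + (1 - η) * f y := by
    intro y hy
    have : η * f c + (1 - η) * f y =
        η * f c * (∑ i, x i y) + (1 - η) * ∑ i, x i y * f (s i) := by
      rw [← hfx y hy, (hxs' y hy).1, mul_one]
    rw [this, Finset.mul_sum, Finset.mul_sum, ← Finset.sum_add_distrib]
    exact Finset.sum_congr rfl fun i _ => by rw [← hfp i]; ring
  have hΘ : ∑ i, x i c * θ i = f c := by rw [hθy c hcs]; ring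
  obtain ⟨o, ε, h1, hε0, hA, h2, h3⟩ := aux_numeric
    (fun i => exists_ne i) θ (fun k => x k c) (fun k => x k v) η hη0 hη hθ0 hθ1
    (fun k => hx0 k c hcs) (fun k => hx0 k v hvs) (hxs' c hcs).1 (hxs' v hvs).1
    (by
      intro i k hik
      have e := hxp i k
      rw [if_neg (Ne.symm hik)] at e
      have : 0 ≤ (1 - θ i) * x k (b i) :=
        mul_nonneg (by linarith [hθ1 i]) (hx0 k _ (hBs _ (hbB i)))
      linarith)
    (by rw [hθy v hvs, hΘ, hf1]; ring)
  simp only [hΘ] at hA h2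
  set A := θ o - η * f c with hAdef
  set j : Fin (n + 1) → Fin (n + 1 + 1) := o.succAbove with hj
  have hjo : ∀ k, j k ≠ o := fun k => Fin.succAbove_ne o k
  have hjj : ∀ i k, j i = j k ↔ i = k := fun i k => Fin.succAbove_right_inj
  have hsum : ∀ (g : Fin (n + 1 + 1) → ℝ),
      ∑ i, g i = g o + ∑ k, g (j k) := fun g => Fin.sum_univ_succAbove g o
  set a : Fin (n + 1) → ℝ := fun k => θ o - θ (j k) with ha
  have ha0 : ∀ k, 0 < a k := fun k => sub_pos.2 (h1 _ (hjo k))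
  set r : Fin (n + 1) → E := fun k => s o + (A / a k) • (s (j k) - s o) with hr
  have hrep1 : ∀ y ∈ B, ∑ k, a k * x (j k) y / A = 1 := by
    intro y hy
    rw [← Finset.sum_div, div_eq_one_iff_eq hA.ne']
    have e1 := (hxs' y (hBs y hy)).1
    have e2 := hθy y (hBs y hy)
    rw [hf0 y hy] at e2
    have e3 : ∑ i, (θ o - θ i) * x i y = A := by
      have : ∑ i, (θ o - θ i) * x i y = θ o * (∑ i, x i y) - ∑ i, x i y * θ i := by
        rw [Finset.mul_sum, ← Finset.sum_sub_distrib]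
        exact Finset.sum_congr rfl fun i _ => by ring
      rw [this, e1, e2]; ring
    rw [hsum] at e3
    simpa using e3
  have hrep2 : ∀ y ∈ B, ∑ k, (a k * x (j k) y / A) • r k = y := by
    intro y hy
    have e1 := (hxs' y (hBs y hy)).1
    have e2 := (hxs' y (hBs y hy)).2
    have e3 : ∀ k, (a k * x (j k) y / A) • r k
        = (a k * x (j k) y / A) • s o + (x (j k) y • s (j k) - x (j k) y • s o) := by
      intro k
      have := (ha0 k).ne'
      have hA' := hA.ne'
      have e : a k * x (j k) y / A * (A / a k) = x (j k) y := by field_simp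
      simp only [hr, smul_add, smul_smul, e, smul_sub]
    simp only [e3, Finset.sum_add_distrib, Finset.sum_sub_distrib, ← Finset.sum_smul]
    rw [hrep1 y hy]
    rw [hsum] at e1
    rw [Fin.sum_univ_succAbove _ o] at e2
    conv_rhs => rw [e2]
    have : ∑ k, x (j k) y = 1 - x o y := by linarith
    rw [this]
    module
  set σ := ∑ k, a k * ε (j k) / A with hσ
  have hσ0 : 0 ≤ σ := Finset.sum_nonneg fun k _ =>
    div_nonneg (mul_nonneg (ha0 k).le (hε0 _)) hA.le
  have hση : σ ≤ η := by
    rw [hσ, ← Finset.sum_div, div_le_iff₀ hA]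
    rw [hsum] at h2
    simpa using h2
  have hθlt : ∀ k, θ (j k) < 1 := fun k => (h1 _ (hjo k)).trans_le (hθ1 o)
  have key : ∀ i, ∑ k, (a k * ε (j k) / A + if i = k then (1 - σ) else 0) • r k ∈ B := by
    intro i
    refine aux_sep hB hBc.isClosed r (fun k => a k * ε (j k) / A)
      (fun i k => a k * x (j k) (b (j i)) / A) (fun i => hrep1 _ (hbB _))
      (fun i => by rw [hrep2 _ (hbB _)]; exact hbB _) ?_ _ ?_ ?_
    · intro i k hik
      refine div_le_div_of_nonneg_right (mul_le_mul_of_nonneg_left ?_ (ha0 k).le) hA.le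
      have hne' : j i ≠ j k := fun h => hik ((hjj i k).1 h)
      have e := hxp (j i) (j k)
      rw [if_neg hne'.symm] at e
      have e' := h3 (j i) (j k) (hjo i) hne'
      have := hθlt i
      refine le_of_mul_le_mul_right ?_ (show 0 < 1 - θ (j i) by linarith)
      linarith
    · rw [Finset.sum_add_distrib]
      simp [← hσ]
    · intro k
      have : 0 ≤ if i = k then (1 - σ) else 0 := by split_ifs <;> linarith
      linarith
  refine ⟨1 / (1 - σ), aux_final hB n r ?_ σ (σ⁻¹ • ∑ k, (a k * ε (j k) / A) • r k) (by linarith) ?_,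
    one_div_le_one_div_of_le (by linarith) (by linarith)⟩
  · intro y hy
    rw [← hrep2 y hy]
    refine (convex_convexHull ℝ _).sum_mem (fun k _ => ?_) (hrep1 y hy)
      (fun k _ => subset_convexHull ℝ _ ⟨k, rfl⟩)
    exact div_nonneg (mul_nonneg (ha0 k).le (hx0 _ _ (hBs y hy))) hA.le
  · intro i
    convert key i using 1
    simp only [add_smul, Finset.sum_add_distrib]
    congr 1
    · rcases eq_or_ne σ 0 with h | h
      · have : ∀ k, a k * ε (j k) / A = 0 := by
          intro k
          exact (Finset.sum_eq_zero_iff_of_nonneg (fun k _ =>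
            div_nonneg (mul_nonneg (ha0 k).le (hε0 _)) hA.le)).1 (hσ.symm.trans h) k
            (Finset.mem_univ _)
        simp [this]
      · rw [smul_inv_smul₀ h]
    · simp [ite_smul]
theorem aux_scale {E : Type*} [NormedAddCommGroup E] [NormedSpace ℝ E] {K : Set E}
    (hK : IsCompact K) (hnt : K.Nontrivial) (ρ : ℝ) (hρ : 0 ≤ ρ) (h : K ⊆ ρ • K) :
    1 ≤ ρ ∧ (1 < ρ → (0 : E) ∈ K) := by
  constructor
  · have h1 : Metric.diam K ≤ ρ * Metric.diam K := by
      have := Metric.diam_mono h (hK.smul ρ).isBounded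
      rwa [diam_smul₀, Real.norm_of_nonneg hρ] at this
    have h2 : 0 < Metric.diam K := Metric.diam_pos hnt hK.isBounded
    exact le_of_mul_le_mul_right (by linarith) h2
  · intro h1
    obtain ⟨x, hx⟩ := hnt.nonempty
    have h2 : ∀ k : ℕ, (ρ⁻¹ ^ k) • x ∈ K := by
      intro k
      induction k with
      | zero => simpa using hx
      | succ k ih =>
        obtain ⟨y, hy, e⟩ := h ih
        have : ρ⁻¹ ^ (k + 1) • x = y := by
          rw [pow_succ', mul_smul, ← e]
          exact inv_smul_smul₀ (by linarith) y
        rwa [this]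
    have h3 : Filter.Tendsto (fun k : ℕ => (ρ⁻¹ ^ k) • x) Filter.atTop (nhds ((0 : ℝ) • x)) :=
      (tendsto_pow_atTop_nhds_zero_of_lt_one (by positivity) (inv_lt_one_of_one_lt₀ h1)).smul_const x
    rw [zero_smul] at h3
    exact hK.isClosed.mem_of_tendsto h3 (Filter.Eventually.of_forall h2)

theorem aux_scale' {E : Type*} [NormedAddCommGroup E] [NormedSpace ℝ E] {K : Set E}
    (hK : IsCompact K) (hnt : K.Nontrivial) (ρ : ℝ) (hρ : 0 ≤ ρ) (u : E)
    (h : (· + u) '' K ⊆ ρ • ((· + u) '' K)) :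
    1 ≤ ρ ∧ (1 < ρ → -u ∈ K) := by
  obtain ⟨h1, h2⟩ := aux_scale (hK.image (continuous_add_const u))
    (hnt.image (add_left_injective u)) ρ hρ h
  refine ⟨h1, fun h3 => ?_⟩
  obtain ⟨y, hy, e⟩ := h2 h3
  have : y = -u := eq_neg_of_add_eq_zero_left e
  rwa [← this]

theorem aux_nontrivial {E : Type*} [AddCommGroup E] [Module ℝ E] {K : Set E} {n : ℕ} (hn : 1 ≤ n)
    (h : Module.finrank ℝ (vectorSpan ℝ K) = n) : K.Nontrivial := by
  by_contra h1
  rw [Set.not_nontrivial_iff] at h1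
  rw [vectorSpan_of_subsingleton ℝ h1] at h
  simp at h
  omega

theorem aux_compact {E : Type*} [NormedAddCommGroup E] [NormedSpace ℝ E] {B : Set E}
    (hB : Convex ℝ B) (hBc : IsCompact B) (hne : B.Nonempty) (v : E) :
    IsCompact (convexHull ℝ (insert v B)) := by
  have : convexHull ℝ (insert v B) =
      (fun p : ℝ × E => p.1 • v + (1 - p.1) • p.2) '' (Set.Icc 0 1 ×ˢ B) := by
    ext p
    constructor
    · intro hp
      obtain ⟨θ, b, h0, h1, hb, rfl⟩ := aux_mem_insert hB hne v p hp
      exact ⟨(θ, b), ⟨⟨h0, h1⟩, hb⟩, rfl⟩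
    · rintro ⟨⟨θ, b⟩, ⟨⟨h0, h1⟩, hb⟩, rfl⟩
      exact convex_convexHull ℝ _ (subset_convexHull ℝ _ (Set.mem_insert _ _))
        (subset_convexHull ℝ _ (Set.mem_insert_of_mem _ hb)) h0 (sub_nonneg.2 h1) (by ring)
  rw [this]
  exact (isCompact_Icc.prod hBc).image (by fun_prop)

theorem aux_upper {E : Type*} [NormedAddCommGroup E] [NormedSpace ℝ E] {B : Set E}
    (hBc : IsCompact B) (hnt : B.Nontrivial) (n : ℕ) (v : E) :
    DS B n ⊆ DS (convexHull ℝ (insert v B)) (n + 1) := by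
  rintro ρ ⟨hρ, s, u, h1, h2⟩
  obtain ⟨h3, h4⟩ := aux_scale' hBc hnt ρ hρ u (h1.trans h2)
  have hBC : B ⊆ convexHull ℝ (insert v B) :=
    (Set.subset_insert v B).trans (subset_convexHull ℝ _)
  have hvC : v ∈ convexHull ℝ (insert v B) := subset_convexHull ℝ _ (Set.mem_insert _ _)
  refine ⟨hρ, Fin.cons (v + u) s, u, ?_, ?_⟩
  · rintro _ ⟨y, hy, rfl⟩
    have hy' : y ∈ (AffineMap.id ℝ E + AffineMap.const ℝ E u) ⁻¹'
        (convexHull ℝ (Set.range (Fin.cons (v + u) s : Fin (n + 1 + 1) → E))) := by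
      refine convexHull_min ?_ ((convex_convexHull ℝ _).affine_preimage _) hy
      rw [Fin.range_cons]
      rintro z (rfl | hz)
      · exact subset_convexHull ℝ _ (Set.mem_insert _ _)
      · exact convexHull_mono (Set.subset_insert _ _) (h1 ⟨z, hz, rfl⟩)
    simpa using hy'
  · refine convexHull_min ?_ (aux_convex_img (convex_convexHull ℝ _) u ρ)
    rw [Fin.range_cons]
    rintro z (rfl | hz)
    · rcases h3.eq_or_lt with h | h
      · subst h
        rw [one_smul]
        exact ⟨v, hvC, rfl⟩
      · have hu := hBC (h4 h)
        have hρ0 : 0 < ρ := by linarith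
        refine ⟨ρ⁻¹ • (v + u), ⟨ρ⁻¹ • v + (1 - ρ⁻¹) • (-u), ?_, ?_⟩, ?_⟩
        · exact convex_convexHull ℝ _ hvC hu (by positivity)
            (sub_nonneg.2 (inv_le_one_of_one_le₀ h3)) (by ring)
        · simp only; module
        · exact smul_inv_smul₀ hρ0.ne' _
    · obtain ⟨_, ⟨y, hy, rfl⟩, e⟩ := h2 (subset_convexHull ℝ _ hz)
      exact ⟨_, ⟨y, hBC hy, rfl⟩, e⟩

theorem aux_lower {E : Type*} [NormedAddCommGroup E] [NormedSpace ℝ E] [FiniteDimensional ℝ E]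
    {B : Set E} (hB : Convex ℝ B) (hBc : IsCompact B) (hnt : B.Nontrivial) (n : ℕ)
    (v : E) (hv : v ∉ affineSpan ℝ B)
    (hdim : Module.finrank ℝ (vectorSpan ℝ (insert v B)) = n + 1) (ρ : ℝ)
    (hρ : ρ ∈ DS (convexHull ℝ (insert v B)) (n + 1)) (hρ2 : ρ ≤ 2) :
    ∃ ρ' ∈ DS B n, ρ' ≤ ρ := by
  obtain ⟨hρ0, s, u, h1, h2⟩ := hρ
  have hBC : B ⊆ convexHull ℝ (insert v B) :=
    (Set.subset_insert v B).trans (subset_convexHull ℝ _)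
  have hvC : v ∈ convexHull ℝ (insert v B) := subset_convexHull ℝ _ (Set.mem_insert _ _)
  obtain ⟨h3, h4⟩ := aux_scale' (aux_compact hB hBc hnt.nonempty v) (hnt.mono hBC) ρ hρ0 u
    (h1.trans h2)
  have hpos : 0 < ρ := by linarith
  have hs : convexHull ℝ (insert v B) ⊆ convexHull ℝ (Set.range fun i => s i - u) := by
    intro y hy
    simpa using aux_conv_sub s u _ (h1 ⟨y, hy, rfl⟩)
  have e : ρ = 1 / (1 - (1 - ρ⁻¹)) := by simp
  have hη0 : 0 ≤ 1 - ρ⁻¹ := sub_nonneg.2 (inv_le_one_of_one_le₀ h3)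
  have hη : 1 - ρ⁻¹ ≤ 1 / 2 := by
    have := inv_anti₀ hpos hρ2
    linarith
  have hmem : ∀ i, ∃ y ∈ convexHull ℝ (insert v B), s i = ρ • (y + u) := by
    intro i
    obtain ⟨_, ⟨y, hy, rfl⟩, e⟩ := h2 (subset_convexHull ℝ _ ⟨i, rfl⟩)
    exact ⟨y, hy, e.symm⟩
  rw [e]
  have hfin : ∀ c ∈ convexHull ℝ (insert v B), (1 < ρ → c = -u) →
      ∃ ρ' ∈ DS B n, ρ' ≤ 1 / (1 - (1 - ρ⁻¹)) := by
    intro c hc hcu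
    refine aux_core hB hBc hnt.nonempty n v hv hdim _ hs c hc _ hη0 hη fun i => ?_
    obtain ⟨y, hy, e⟩ := hmem i
    convert hy using 1
    rw [e]
    rcases h3.eq_or_lt with h | h
    · subst h; simp
    · rw [hcu h]
      simp only [smul_sub, sub_sub_cancel, inv_smul_smul₀ hpos.ne']
      module
  rcases h3.eq_or_lt with h | h
  · exact hfin v hvC fun h' => absurd h' (by rw [← h]; exact lt_irrefl _)
  · exact hfin (-u) (h4 h) fun _ => rfl

theorem aux_step {E : Type*} [NormedAddCommGroup E] [NormedSpace ℝ E] [FiniteDimensional ℝ E]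
    {B : Set E} (hB : Convex ℝ B) (hBc : IsCompact B) (hnt : B.Nontrivial) (n : ℕ)
    (v : E) (hv : v ∉ affineSpan ℝ B)
    (hdim : Module.finrank ℝ (vectorSpan ℝ (insert v B)) = n + 1)
    (hne : (DS B n).Nonempty) (h2 : sInf (DS B n) ≤ 2) :
    sInf (DS (convexHull ℝ (insert v B)) (n + 1)) = sInf (DS B n) := by
  have hsub := aux_upper hBc hnt n v
  have hbd : ∀ (K : Set E) (k : ℕ), BddBelow (DS K k) := fun K k => ⟨0, fun ρ h => h.1⟩
  refine le_antisymm (csInf_le_csInf (hbd _ _) hne hsub) ?_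
  refine le_csInf (hne.mono hsub) fun ρ hρ => ?_
  by_cases h : ρ ≤ 2
  · obtain ⟨ρ', h3, h4⟩ := aux_lower hB hBc hnt n v hv hdim ρ hρ h
    exact (csInf_le (hbd _ _) h3).trans h4
  · linarith

theorem aux_nonempty {E : Type*} [NormedAddCommGroup E] [NormedSpace ℝ E] [FiniteDimensional ℝ E]
    {B : Set E} (hB : Convex ℝ B) (hBc : IsCompact B) (hne : B.Nonempty) (n : ℕ)
    (hdim : Module.finrank ℝ (vectorSpan ℝ B) = n) : (DS B n).Nonempty := by
  obtain ⟨t, htB, htspan, hti⟩ := exists_affineIndependent ℝ E B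
  have hfin : t.Finite := finite_set_of_fin_dim_affineIndependent ℝ hti
  haveI : Fintype t := hfin.fintype
  haveI : Nonempty t := by
    have : (affineSpan ℝ t : Set E).Nonempty := by
      rw [htspan]; exact (affineSpan_nonempty ℝ).2 hne
    exact ((affineSpan_nonempty ℝ).1 this).to_subtype
  have hcard : Fintype.card t = n + 1 := by
    rw [← hti.finrank_vectorSpan_add_one, Subtype.range_coe, ← direction_affineSpan, htspan,
      direction_affineSpan, hdim]
  let eqv : Fin (n + 1) ≃ t := (Fintype.equivFinOfCardEq hcard).symm
  let b : Fin (n + 1) → E := fun i => (eqv i : E)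
  have hbi : AffineIndependent ℝ b := hti.comp_embedding eqv.toEmbedding
  have hbB : ∀ i, b i ∈ B := fun i => htB (eqv i).2
  have hrange : Set.range b = t := by
    have : b = Subtype.val ∘ eqv := rfl
    rw [this, Set.range_comp, eqv.range_eq_univ, Set.image_univ, Subtype.range_coe]
  obtain ⟨x, hx, hxs⟩ := aux_coords b hbi
  rw [hrange, htspan] at hxs
  have hbound : ∀ k, ∃ M : ℝ, ∀ y ∈ B, ‖x k y‖ ≤ M := fun k =>
    hBc.exists_bound_of_continuousOn (x k).continuous_of_finiteDimensional.continuousOn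
  choose M hM using hbound
  set N : ℝ := (n + 1 : ℝ) with hN
  have hN0 : 0 < N := by positivity
  set R : ℝ := 1 + N * ∑ k, |M k| with hR
  have hS0 : 0 ≤ ∑ k, |M k| := Finset.sum_nonneg fun k _ => abs_nonneg _
  have hR1 : 1 ≤ R := by
    have : 0 ≤ N * ∑ k, |M k| := by positivity
    linarith
  have hR0 : 0 < R := by linarith
  set g : E := ∑ k, (1 / N) • b k with hg
  refine ⟨_, aux_final hB n (fun i => g + R • (b i - g)) ?_ (1 - R⁻¹) g
    (by have := inv_pos.2 hR0; linarith) ?_⟩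
  · intro y hy
    obtain ⟨hy1, hy2⟩ := hxs y (mem_affineSpan ℝ hy)
    have e1 : ∑ k, (1 / N + (x k y - 1 / N) * R⁻¹) = 1 := by
      rw [Finset.sum_add_distrib, ← Finset.sum_mul, Finset.sum_sub_distrib, hy1]
      have : ∑ k : Fin (n + 1), 1 / N = 1 := by
        simp [hN]
        field_simp
      rw [this]; ring
    have e2 : ∑ k, (1 / N + (x k y - 1 / N) * R⁻¹) • (g + R • (b k - g)) = y := by
      have : ∀ k, (1 / N + (x k y - 1 / N) * R⁻¹) • (g + R • (b k - g)) =
          (1 / N + (x k y - 1 / N) * R⁻¹) • ((1 - R) • g) + (R - 1) • ((1 / N) • b k)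
            + x k y • b k := by
        intro k
        have e : (1 / N + (x k y - 1 / N) * R⁻¹) * R = (R - 1) * (1 / N) + x k y := by
          field_simp; ring
        rw [show g + R • (b k - g) = (1 - R) • g + R • b k by module, smul_add, smul_smul _ R, e,
          add_smul ((R - 1) * (1 / N)), mul_smul (R - 1), add_assoc]
      rw [Finset.sum_congr rfl (fun k _ => this k), Finset.sum_add_distrib,
        Finset.sum_add_distrib, ← Finset.sum_smul, e1,
        ← Finset.smul_sum (r := R - 1), ← hg, ← hy2]
      module
    rw [← e2]
    refine (convex_convexHull ℝ _).sum_mem (fun k _ => ?_) e1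
      (fun k _ => subset_convexHull ℝ _ ⟨k, rfl⟩)
    have h1 : -(∑ k, |M k|) ≤ x k y := by
      have h2 := hM k y hy
      have h3 : |M k| ≤ ∑ k, |M k| :=
        Finset.single_le_sum (f := fun k => |M k|) (fun k _ => abs_nonneg _) (Finset.mem_univ k)
      have h4 := neg_abs_le (x k y)
      rw [Real.norm_eq_abs] at h2
      linarith [le_abs_self (M k)]
    have : 1 / N + (x k y - 1 / N) * R⁻¹ = (∑ k, |M k| + x k y) * R⁻¹ := by
      field_simp
      rw [hR]; ring
    rw [this]
    exact mul_nonneg (by linarith) (by positivity)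
  · intro i
    convert hbB i using 1
    simp only [sub_sub_cancel, smul_add, inv_smul_smul₀ hR0.ne']
    module

theorem aux_dim {E : Type*} [NormedAddCommGroup E] [NormedSpace ℝ E] [FiniteDimensional ℝ E]
    (m : ℕ) (B : Set E) (v : Fin m → E) :
    Module.finrank ℝ (vectorSpan ℝ (B ∪ Set.range v)) ≤ Module.finrank ℝ (vectorSpan ℝ B) + m := by
  induction m generalizing B with
  | zero => rw [Set.range_eq_empty v, Set.union_empty]; simp
  | succ m ih =>
    have e : B ∪ Set.range v = insert (v 0) B ∪ Set.range (Fin.tail v) := by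
      rw [← Fin.cons_self_tail v, Fin.range_cons]
      simp [Set.insert_union]
    rw [e]
    have := ih (insert (v 0) B) (Fin.tail v)
    have h2 := finrank_vectorSpan_insert_le_set ℝ B (v 0)
    omega

theorem aux_main {E : Type*} [NormedAddCommGroup E] [NormedSpace ℝ E] [FiniteDimensional ℝ E]
    (m n : ℕ) (hn : 1 ≤ n) (B : Set E) (hB : Convex ℝ B) (hBc : IsCompact B)
    (hdim : Module.finrank ℝ (vectorSpan ℝ B) = n) (v : Fin m → E)
    (hdimC : Module.finrank ℝ (vectorSpan ℝ (B ∪ Set.range v)) = n + m)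
    (h2 : sInf (DS B n) ≤ 2) :
    sInf (DS (convexHull ℝ (B ∪ Set.range v)) (n + m)) = sInf (DS B n) := by
  induction m generalizing n B with
  | zero => simp [hB.convexHull_eq]
  | succ m ih =>
    have e : B ∪ Set.range v = insert (v 0) B ∪ Set.range (Fin.tail v) := by
      rw [← Fin.cons_self_tail v, Fin.range_cons]
      simp [Set.insert_union]
    have hnt := aux_nontrivial hn hdim
    have hvs : ∀ S T : Set E, affineSpan ℝ S = affineSpan ℝ T → vectorSpan ℝ S = vectorSpan ℝ T := by
      intro S T h
      rw [← direction_affineSpan, h, direction_affineSpan]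
    have d1 := aux_dim m (insert (v 0) B) (Fin.tail v)
    rw [← e, hdimC] at d1
    have d2 := finrank_vectorSpan_insert_le_set ℝ B (v 0)
    have d3 : Module.finrank ℝ (vectorSpan ℝ (insert (v 0) B)) = n + 1 := by omega
    have hv : v 0 ∉ affineSpan ℝ B := by
      intro h
      rw [hvs _ _ (affineSpan_insert_eq_affineSpan ℝ h)] at d3
      omega
    have hstep := aux_step hB hBc hnt n (v 0) hv d3 (aux_nonempty hB hBc hnt.nonempty n hdim) h2
    have hI := ih (n + 1) (by omega) (convexHull ℝ (insert (v 0) B)) (convex_convexHull ℝ _)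
      (aux_compact hB hBc hnt.nonempty _)
      (by rw [hvs _ _ (affineSpan_convexHull _), d3]) (Fin.tail v)
      (by
        rw [← hvs _ _ (affineSpan_convexHull _), convexHull_convexHull_union_left, ← e,
          hvs _ _ (affineSpan_convexHull _), hdimC]
        omega)
      (by rw [hstep]; exact h2)
    rw [convexHull_convexHull_union_left, ← e, hstep] at hI
    rw [← hI, Nat.add_assoc, Nat.add_comm 1 m]

/-- for an `n`-dimensional convex body `B ⊆ ℝⁿ⁺ᵐ` with
`d_BM(B, Δⁿ) ≤ 2` and points `v¹, …, vᵐ` such that `C = conv(B ∪ {v¹,…,vᵐ})` is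
`(n+m)`-dimensional, one has `d_BM(C, Δⁿ⁺ᵐ) = d_BM(B, Δⁿ)`. -/
theorem stmt_14 (n m : ℕ) (hn : 1 ≤ n) (hm : 1 ≤ m)
    (B : Set (Fin (n + m) → ℝ)) (hBconv : Convex ℝ B) (hBcomp : IsCompact B)
    (hBdim : Module.finrank ℝ (affineSpan ℝ B).direction = n)
    (w : Fin (n + 1) → (Fin n → ℝ)) (hw : AffineIndependent ℝ w)
    (W : Fin (n + m + 1) → (Fin (n + m) → ℝ)) (hW : AffineIndependent ℝ W)
    (v : Fin m → (Fin (n + m) → ℝ))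
    (C : Set (Fin (n + m) → ℝ)) (hC : C = convexHull ℝ (B ∪ Set.range v))
    (hCdim : affineSpan ℝ C = ⊤)
    (h2 : dBMSet B (convexHull ℝ (Set.range w)) ≤ 2) :
    dBMSet C (convexHull ℝ (Set.range W)) = dBMSet B (convexHull ℝ (Set.range w)) := by
  subst hC
  rw [dBM_eq _ _ W hW, dBM_eq _ _ w hw]
  rw [dBM_eq _ _ w hw] at h2
  rw [direction_affineSpan] at hBdim
  refine aux_main m n hn B hBconv hBcomp hBdim v ?_ h2
  rw [affineSpan_convexHull] at hCdim
  rw [← direction_affineSpan, hCdim, AffineSubspace.direction_top, finrank_top]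
  simp
end
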